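/- arXiv:2407.02021 — 3 statements merged into one kernel-verified Lean document; each statement's English description precedes it below -/
import Mathlib

section
/- Let R be an LG-ring, let S be a quadratic étale R-algebra with standard involution σ, and let h₁, h₂, h₃ be hermitian spaces over (S, σ). If the orthogonal sums h₁ ⊥ h₃ and h₂ ⊥ h₃ are isometric, then h₁ and h₂ are isometric. -/
open TensorProduct

universe u

/-- A commutative ring `R` is an LG-ring ("local-global ring") if every multivariate
polynomial over `R` that represents a unit over every residue field `R/𝔪` at a maximal
ideal `𝔪` already represents a unit over `R`. -/
def IsLGRing (R : Type*) [CommRing R] : Prop :=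
  ∀ n : ℕ, 1 ≤ n → ∀ f : MvPolynomial (Fin n) R,
    (∀ 𝔪 : Ideal R, 𝔪.IsMaximal →
      ∃ v : Fin n → R ⧸ 𝔪, IsUnit (MvPolynomial.eval v
        (MvPolynomial.map (Ideal.Quotient.mk 𝔪) f))) →
    ∃ u : Fin n → R, IsUnit (MvPolynomial.eval u f)

/-- A module `M` over `R` has constant rank `r` if for every prime ideal `𝔭` of `R` the
localization `M_𝔭` is a free module of rank `r` over `R_𝔭`. -/
def HasConstantRank (R : Type u) (M : Type u) [CommRing R] [AddCommGroup M] [Module R M]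
    (r : ℕ) : Prop :=
  ∀ (p : Ideal R) (_ : p.IsPrime),
    Nonempty (LocalizedModule p.primeCompl M ≃ₗ[Localization p.primeCompl]
      (Fin r → Localization p.primeCompl))

/-- `h` is an `(S,σ)`-hermitian form on the `S`-module `M`:  it is biadditive,
`σ`-sesquilinear in the first variable, linear in the second variable, and
`σ`-symmetric. -/
def IsHermitianForm {R S : Type u} [CommRing R] [CommRing S] [Algebra R S]
    (σ : S →ₐ[R] S) {M : Type u} [AddCommGroup M] [Module S M] (h : M → M → S) : Prop :=
  (∀ m m₁ m₂ : M, h (m₁ + m₂) m = h m₁ m + h m₂ m) ∧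
  (∀ m m₁ m₂ : M, h m (m₁ + m₂) = h m m₁ + h m m₂) ∧
  (∀ (s : S) (m m' : M), h (s • m) m' = σ s * h m m') ∧
  (∀ (s : S) (m m' : M), h m (s • m') = h m m' * s) ∧
  (∀ m m' : M, h m' m = σ (h m m'))

/-- A sesquilinear form `h` on `M` is regular if the adjoint map
`M → Hom_S(M, S)`, `m ↦ h(m, −)`, is bijective. -/
def IsRegularForm {S : Type u} [CommRing S] {M : Type u} [AddCommGroup M] [Module S M]
    (h : M → M → S) : Prop :=
  (∀ m m' : M, (∀ x : M, h m x = h m' x) → m = m') ∧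
  (∀ φ : M →ₗ[S] S, ∃ m : M, ∀ x : M, h m x = φ x)

namespace LGC
/-- orthogonal sum -/
def psum {S M N : Type u} [CommRing S] (h : M → M → S) (k : N → N → S) : M × N → M × N → S :=
  fun p q => h p.1 q.1 + k p.2 q.2

/-- hyperbolic plane -/
def hyp {R S : Type u} [CommRing R] [CommRing S] [Algebra R S]
    (σ : S →ₐ[R] S) : S × S → S × S → S :=
  fun p q => σ p.1 * q.2 + σ p.2 * q.1

/-- isometric forms -/
def Isom {S M N : Type u} [CommRing S] [AddCommGroup M] [Module S M] [AddCommGroup N] [Module S N]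
    (h : M → M → S) (k : N → N → S) : Prop :=
  ∃ g : M ≃ₗ[S] N, ∀ m m' : M, k (g m) (g m') = h m m'

section
variable {R S : Type u} [CommRing R] [CommRing S] [Algebra R S] {σ : S →ₐ[R] S}
  {M N M' N' : Type u} [AddCommGroup M] [Module S M] [AddCommGroup N] [Module S N]
  [AddCommGroup M'] [Module S M'] [AddCommGroup N'] [Module S N']
  {h : M → M → S} {k : N → N → S} {h' : M' → M' → S} {k' : N' → N' → S}

theorem Isom.symm (H : Isom h k) : Isom k h := by
  obtain ⟨g, hg⟩ := H
  exact ⟨g.symm, fun m m' => by rw [← hg]; simp⟩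

theorem Isom.trans (H : Isom h k) (H' : Isom k h') : Isom h h' := by
  obtain ⟨g, hg⟩ := H
  obtain ⟨g', hg'⟩ := H'
  exact ⟨g.trans g', fun m m' => by simp [hg, hg']⟩

theorem Isom.refl (h : M → M → S) : Isom h h := ⟨LinearEquiv.refl S M, fun _ _ => rfl⟩

theorem Isom.psum (H : Isom h k) (H' : Isom h' k') : Isom (psum h h') (psum k k') := by
  obtain ⟨g, hg⟩ := H
  obtain ⟨g', hg'⟩ := H'
  exact ⟨g.prodCongr g', fun m m' => by simp [LGC.psum, hg, hg']⟩

theorem psum_assoc (h : M → M → S) (k : N → N → S) (h' : M' → M' → S) :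
    Isom (psum (psum h k) h') (psum h (psum k h')) :=
  ⟨LinearEquiv.prodAssoc S M N M', fun m m' => by simp [LGC.psum, add_assoc]⟩

theorem herm_psum (H : IsHermitianForm σ h) (K : IsHermitianForm σ k) :
    IsHermitianForm σ (psum h k) := by
  obtain ⟨a1, a2, a3, a4, a5⟩ := H
  obtain ⟨b1, b2, b3, b4, b5⟩ := K
  refine ⟨fun m x y => ?_, fun m x y => ?_, fun s x y => ?_, fun s x y => ?_, fun x y => ?_⟩
  · simp only [psum, Prod.fst_add, Prod.snd_add, a1, b1]; ring
  · simp only [psum, Prod.fst_add, Prod.snd_add, a2, b2]; ring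
  · simp only [psum, Prod.smul_fst, Prod.smul_snd, a3, b3]; ring
  · simp only [psum, Prod.smul_fst, Prod.smul_snd, a4, b4]; ring
  · simp only [psum, map_add, ← a5, ← b5]

theorem herm_hyp (hσ : ∀ s, σ (σ s) = s) : IsHermitianForm σ (hyp σ) := by
  refine ⟨fun m x y => ?_, fun m x y => ?_, fun s x y => ?_, fun s x y => ?_, fun x y => ?_⟩
  all_goals simp [hyp, hσ]
  all_goals ring

theorem zero_left (H : IsHermitianForm σ h) (m : M) : h 0 m = 0 := by
  have := H.2.2.1 0 0 m
  simpa using this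
theorem zero_right (H : IsHermitianForm σ h) (m : M) : h m 0 = 0 := by
  have := H.2.2.2.1 0 m 0
  simpa using this
theorem neg_left (H : IsHermitianForm σ h) (m m' : M) : h (-m) m' = - h m m' := by
  have := H.2.2.1 (-1) m m'
  simpa using this
theorem neg_right (H : IsHermitianForm σ h) (m m' : M) : h m (-m') = - h m m' := by
  have := H.2.2.2.1 (-1) m m'
  simpa using this

/-- the Eichler transformation as a linear map -/
def eich (H : IsHermitianForm σ h) (w : M) (q : S) : M × (S × S) →ₗ[S] M × (S × S) where
  toFun p := (p.1 + p.2.2 • w, (p.2.1 - h w p.1 - q * p.2.2, p.2.2))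
  map_add' p p' := by
    simp only [Prod.fst_add, Prod.snd_add, H.2.1, Prod.mk_add_mk, Prod.mk.injEq, and_true]
    exact ⟨by module, by ring⟩
  map_smul' s p := by
    simp only [Prod.smul_fst, Prod.smul_snd, H.2.2.2.1, Prod.smul_mk, RingHom.id_apply, smul_eq_mul,
      Prod.mk.injEq, and_true]
    exact ⟨by module, by ring⟩

/-- the Eichler transformation as an equivalence -/
def eichE (H : IsHermitianForm σ h) (w : M) (q : S) (hq : q + σ q = h w w) :
    (M × (S × S)) ≃ₗ[S] M × (S × S) :=
  LinearEquiv.ofLinearMap (eich H w q) (eich H (-w) (σ q))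
    (by
      ext p <;> simp [eich, neg_left H, neg_right H, H.2.1, H.2.2.2.1, zero_right H, ← hq])
    (by
      ext p <;> simp [eich, neg_left H, neg_right H, H.2.1, H.2.2.2.1, zero_right H, ← hq])

theorem eichE_apply (H : IsHermitianForm σ h) (w : M) (q : S) (hq : q + σ q = h w w) (p) :
    eichE H w q hq p = (p.1 + p.2.2 • w, (p.2.1 - h w p.1 - q * p.2.2, p.2.2)) := rfl

theorem eichE_isom (H : IsHermitianForm σ h) (w : M) (q : S) (hq : q + σ q = h w w) (p p') :
    psum h (hyp σ) (eichE H w q hq p) (eichE H w q hq p') = psum h (hyp σ) p p' := by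
  simp only [eichE_apply, psum, hyp, H.1, H.2.1, H.2.2.1, H.2.2.2.1, map_sub, map_mul,
    ← H.2.2.2.2]
  linear_combination - σ p.2.2 * p'.2.2 * hq

/-- swap -/
def swapE : (M × (S × S)) ≃ₗ[S] M × (S × S) :=
  (LinearEquiv.refl S M).prodCongr (LinearEquiv.prodComm S S S)

theorem swapE_apply (p : M × (S × S)) : swapE p = (p.1, (p.2.2, p.2.1)) := rfl

theorem swapE_isom (p p' : M × (S × S)) :
    psum h (hyp σ) (swapE p) (swapE p') = psum h (hyp σ) p p' := by
  simp only [swapE_apply, psum, hyp]; ring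

theorem canc1 (hσ : ∀ s, σ (σ s) = s) (H : IsHermitianForm σ h) (K : IsHermitianForm σ k)
    (F : (M × (S × S)) ≃ₗ[S] N × (S × S))
    (hF : ∀ p q, psum k (hyp σ) (F p) (F q) = psum h (hyp σ) p q)
    (he : F (0, 1, 0) = (0, 1, 0)) (hf : F (0, 0, 1) = (0, 0, 1)) : Isom h k := by
  have key : ∀ m, F (m, 0) = ((F (m, 0)).1, 0) := by
    intro m
    have h1 := hF (0, 1, 0) (m, 0)
    have h2 := hF (0, 0, 1) (m, 0)
    rw [he] at h1
    rw [hf] at h2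
    simp [psum, hyp, zero_left H, zero_left K] at h1 h2
    ext <;> simp [h1, h2]
  have key' : ∀ n, F.symm (n, 0) = ((F.symm (n, 0)).1, 0) := by
    intro n
    have h1 := hF (0, 1, 0) (F.symm (n, 0))
    have h2 := hF (0, 0, 1) (F.symm (n, 0))
    rw [he] at h1
    rw [hf] at h2
    simp [psum, hyp, zero_left H, zero_left K] at h1 h2
    ext <;> simp [← h1, ← h2]
  refine ⟨LinearEquiv.ofLinear
    (LinearMap.fst S N (S × S) ∘ₗ F.toLinearMap ∘ₗ LinearMap.inl S M (S × S))
    (LinearMap.fst S M (S × S) ∘ₗ F.symm.toLinearMap ∘ₗ LinearMap.inl S N (S × S)) ?_ ?_, ?_⟩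
  · ext n
    simp only [LinearMap.comp_apply, LinearMap.inl_apply, LinearMap.fst_apply, LinearEquiv.coe_coe,
      LinearMap.id_apply]
    rw [← key']; simp
  · ext n
    simp only [LinearMap.comp_apply, LinearMap.inl_apply, LinearMap.fst_apply, LinearEquiv.coe_coe,
      LinearMap.id_apply]
    rw [← key]; simp
  · intro m m'
    have := hF (m, 0) (m', 0)
    rw [key m, key m'] at this
    simpa [psum, hyp] using this

theorem canc2 (hσ : ∀ s, σ (σ s) = s) (H : IsHermitianForm σ h) (K : IsHermitianForm σ k)
    (F : (M × (S × S)) ≃ₗ[S] N × (S × S))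
    (hF : ∀ p q, psum k (hyp σ) (F p) (F q) = psum h (hyp σ) p q)
    (he : F (0, 1, 0) = (0, 1, 0)) : Isom h k := by
  obtain ⟨⟨n, a, b⟩, hf⟩ : ∃ v, v = F (0, 0, 1) := ⟨_, rfl⟩
  have h1 := hF (0, 1, 0) (0, 0, 1)
  have h2 := hF (0, 0, 1) (0, 0, 1)
  rw [he, ← hf] at h1
  rw [← hf] at h2
  simp [psum, hyp, zero_left H, zero_left K] at h1 h2
  subst h1
  have hq : (-σ a) + σ (-σ a) = k (-n) (-n) := by
    simp only [map_neg, hσ, neg_left K, neg_right K]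
    simp at h2
    linear_combination -h2
  refine canc1 hσ H K (F.trans (eichE K (-n) (-σ a) hq)) ?_ ?_ ?_
  · intro p q
    simp only [LinearEquiv.trans_apply, eichE_isom, hF]
  · simp [he, eichE_apply, zero_right K]
  · simp [← hf, eichE_apply, neg_left K]
    simp at h2
    linear_combination h2

theorem canc3 (hσ : ∀ s, σ (σ s) = s) (H : IsHermitianForm σ h) (K : IsHermitianForm σ k)
    (F : (M × (S × S)) ≃ₗ[S] N × (S × S))
    (hF : ∀ p q, psum k (hyp σ) (F p) (F q) = psum h (hyp σ) p q)
    (he : (F (0, 1, 0)).2.1 = 1) : Isom h k := by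
  obtain ⟨⟨n, a, b⟩, hf⟩ : ∃ v, v = F (0, 1, 0) := ⟨_, rfl⟩
  have h2 := hF (0, 1, 0) (0, 1, 0)
  rw [← hf] at h2 he
  simp [psum, hyp, zero_left H] at h2 he
  subst he
  simp at h2
  have hq : (-σ b) + σ (-σ b) = k (-n) (-n) := by
    simp only [map_neg, hσ, neg_left K, neg_right K]
    linear_combination -h2
  refine canc2 hσ H K (((F.trans swapE).trans (eichE K (-n) (-σ b) hq)).trans swapE) ?_ ?_
  · intro p q
    simp only [LinearEquiv.trans_apply, eichE_isom, swapE_isom, hF]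
  · simp [← hf, eichE_apply, swapE_apply, neg_left K]
    linear_combination h2

/-- scaling -/
def scaleE (σ : S →ₐ[R] S) (l : Sˣ) : (M × (S × S)) ≃ₗ[S] M × (S × S) :=
  (LinearEquiv.refl S M).prodCongr
    ((LinearEquiv.smulOfUnit l⁻¹).prodCongr (LinearEquiv.smulOfUnit (Units.map σ.toMonoidHom l)))

theorem scaleE_apply (l : Sˣ) (p : M × (S × S)) :
    scaleE σ l p = (p.1, ((l⁻¹ : Sˣ) : S) * p.2.1, σ l * p.2.2) := rfl

theorem scaleE_isom (hσ : ∀ s, σ (σ s) = s) (l : Sˣ) (p p' : M × (S × S)) :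
    psum h (hyp σ) (scaleE σ l p) (scaleE σ l p') = psum h (hyp σ) p p' := by
  have h1 : σ ((l⁻¹ : Sˣ) : S) * σ l = 1 := by rw [← map_mul]; simp
  have h2 : ((l⁻¹ : Sˣ) : S) * l = 1 := by simp
  simp only [scaleE_apply, psum, hyp, map_mul, hσ]
  linear_combination (σ p.2.1 * p'.2.2) * h1 + (σ p.2.2 * p'.2.1) * h2

theorem canc4 (hσ : ∀ s, σ (σ s) = s) (H : IsHermitianForm σ h) (K : IsHermitianForm σ k)
    (F : (M × (S × S)) ≃ₗ[S] N × (S × S))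
    (hF : ∀ p q, psum k (hyp σ) (F p) (F q) = psum h (hyp σ) p q)
    (he : IsUnit (F (0, 1, 0)).2.1) : Isom h k := by
  obtain ⟨l, hl⟩ := he
  refine canc3 hσ H K (F.trans (scaleE σ l)) ?_ ?_
  · intro p q
    simp only [LinearEquiv.trans_apply, scaleE_isom hσ, hF]
  · simp [scaleE_apply, ← hl]

theorem canc5 (hσ : ∀ s, σ (σ s) = s) {θ : S} (hθ : θ + σ θ = 1)
    (hU : ∀ α β γ ν g a b : S, γ + α * b + β * a = 1 → ν + σ α * β + α * σ β = 0 →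
      ∃ s r t : S, IsUnit (α - (σ s * γ + σ r * ν) -
        (θ * (s * σ s * g + σ s * r * γ + σ r * s * σ γ + r * σ r * ν) + t - σ t) * β))
    (H : IsHermitianForm σ h) (K : IsHermitianForm σ k)
    (HI : Isom (psum h (hyp σ)) (psum k (hyp σ))) : Isom h k := by
  obtain ⟨F, hF⟩ := HI
  obtain ⟨⟨m, α, β⟩, he⟩ : ∃ v, v = F (0, 1, 0) := ⟨_, rfl⟩
  obtain ⟨⟨m', α', β'⟩, hf⟩ : ∃ v, v = F (0, 0, 1) := ⟨_, rfl⟩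
  have h1 := hF (0, 1, 0) (0, 1, 0)
  have h2 := hF (0, 0, 1) (0, 1, 0)
  rw [← he] at h1 h2
  rw [← hf] at h2
  simp [psum, hyp, zero_left H] at h1 h2
  obtain ⟨s, r, t, hu⟩ := hU α β (k m' m) (k m m) (k m' m') (σ α') (σ β')
    (by linear_combination h2) (by linear_combination h1)
  have hw : k (s • m' + r • m) (s • m' + r • m) =
      s * σ s * k m' m' + σ s * r * k m' m + σ r * s * σ (k m' m) + r * σ r * k m m := by
    simp only [K.1, K.2.1, K.2.2.1, K.2.2.2.1, ← K.2.2.2.2]; ring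
  have hq : (θ * k (s • m' + r • m) (s • m' + r • m) + t - σ t) +
      σ (θ * k (s • m' + r • m) (s • m' + r • m) + t - σ t) =
      k (s • m' + r • m) (s • m' + r • m) := by
    simp only [map_add, map_sub, map_mul, hσ, ← K.2.2.2.2]
    linear_combination k (s • m' + r • m) (s • m' + r • m) * hθ
  refine canc4 hσ H K (F.trans (eichE K _ _ hq)) ?_ ?_
  · intro p q
    simp only [LinearEquiv.trans_apply, eichE_isom, hF]
  · simp only [LinearEquiv.trans_apply, ← he, eichE_apply]
    convert hu using 1
    rw [hw, K.1, K.2.2.1, K.2.2.1]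


/-- hyperbolic space of rank `2 n` -/
def hypn (σ : S →ₐ[R] S) (n : ℕ) :
    ((Fin n → S) × (Fin n → S)) → ((Fin n → S) × (Fin n → S)) → S :=
  fun p q => ∑ i, (σ (p.1 i) * q.2 i + σ (p.2 i) * q.1 i)

theorem herm_hypn (hσ : ∀ s, σ (σ s) = s) (n : ℕ) : IsHermitianForm σ (hypn σ n) := by
  refine ⟨fun m x y => ?_, fun m x y => ?_, fun s x y => ?_, fun s x y => ?_, fun x y => ?_⟩
  · simp only [hypn, Prod.fst_add, Prod.snd_add, Pi.add_apply, map_add, ← Finset.sum_add_distrib]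
    exact Finset.sum_congr rfl fun i _ => by ring
  · simp only [hypn, Prod.fst_add, Prod.snd_add, Pi.add_apply, ← Finset.sum_add_distrib]
    exact Finset.sum_congr rfl fun i _ => by ring
  · simp only [hypn, Prod.smul_fst, Prod.smul_snd, Pi.smul_apply, smul_eq_mul, map_mul,
      Finset.mul_sum]
    exact Finset.sum_congr rfl fun i _ => by ring
  · simp only [hypn, Prod.smul_fst, Prod.smul_snd, Pi.smul_apply, smul_eq_mul,
      Finset.sum_mul]
    exact Finset.sum_congr rfl fun i _ => by ring
  · simp only [hypn, map_sum, map_add, map_mul, hσ]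
    exact Finset.sum_congr rfl fun i _ => by ring

/-- splitting off a hyperbolic plane -/
def hypnE (S : Type u) [CommRing S] (n : ℕ) : ((Fin (n + 1) → S) × (Fin (n + 1) → S)) ≃ₗ[S]
    ((Fin n → S) × (Fin n → S)) × (S × S) where
  toFun p := ((fun i => p.1 i.succ, fun i => p.2 i.succ), (p.1 0, p.2 0))
  invFun p := (Fin.cons p.2.1 p.1.1, Fin.cons p.2.2 p.1.2)
  map_add' p q := rfl
  map_smul' s p := rfl
  left_inv p := by
    ext i
    · refine Fin.cases ?_ (fun j => ?_) i <;> simp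
    · refine Fin.cases ?_ (fun j => ?_) i <;> simp
  right_inv p := by simp

theorem hypn_succ (σ : S →ₐ[R] S) (n : ℕ) :
    Isom (hypn σ (n + 1)) (psum (hypn σ n) (hyp σ)) := by
  refine ⟨hypnE S n, fun p q => ?_⟩
  simp only [hypnE, psum, hypn, hyp, LinearEquiv.coe_mk, LinearMap.coe_mk, AddHom.coe_mk,
    Fin.sum_univ_succ]
  ring

theorem canc_n (hσ : ∀ s, σ (σ s) = s) {θ : S} (hθ : θ + σ θ = 1)
    (hU : ∀ α β γ ν g a b : S, γ + α * b + β * a = 1 → ν + σ α * β + α * σ β = 0 →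
      ∃ s r t : S, IsUnit (α - (σ s * γ + σ r * ν) -
        (θ * (s * σ s * g + σ s * r * γ + σ r * s * σ γ + r * σ r * ν) + t - σ t) * β))
    (H : IsHermitianForm σ h) (K : IsHermitianForm σ k) (n : ℕ)
    (HI : Isom (psum h (hypn σ n)) (psum k (hypn σ n))) : Isom h k := by
  induction n with
  | zero =>
    obtain ⟨g, hg⟩ := HI
    let : Unique ((Fin 0 → S) × (Fin 0 → S)) :=
      { default := 0, uniq := fun p => Subsingleton.elim _ _ }
    refine ⟨(LinearEquiv.prodUnique.symm.trans g).trans LinearEquiv.prodUnique, fun m m' => ?_⟩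
    have := hg (m, 0) (m', 0)
    simp only [psum, hypn, Finset.univ_eq_empty, Finset.sum_empty, add_zero] at this
    exact this
  | succ n ih =>
    apply ih
    refine canc5 hσ hθ hU (herm_psum H (herm_hypn hσ n)) (herm_psum K (herm_hypn hσ n)) ?_
    refine (psum_assoc _ _ _).trans (((Isom.refl h).psum (hypn_succ σ n).symm).trans ?_)
    exact HI.trans (((Isom.refl k).psum (hypn_succ σ n)).trans (psum_assoc _ _ _).symm)

theorem embed (hσ : ∀ s, σ (σ s) = s) {θ : S} (hθ : θ + σ θ = 1) [Module.Finite S M]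
    [Module.Projective S M] (H : IsHermitianForm σ h) :
    ∃ n, ∃ j : M →ₗ[S] ((Fin n → S) × (Fin n → S)), ∀ m m', hypn σ n (j m) (j m') = h m m' := by
  obtain ⟨n, p, i, hp, hi, hpi⟩ := Module.Finite.exists_comp_eq_id_of_projective S M
  let ψ : M →ₗ[S] (Fin n → S) :=
    { toFun := fun m j => θ * h (p (Pi.single j 1)) m
      map_add' := fun x y => by ext j; simp only [H.2.1, Pi.add_apply]; ring
      map_smul' := fun s x => by
        ext j; simp only [H.2.2.2.1, Pi.smul_apply, smul_eq_mul, RingHom.id_apply]; ring }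
  have key : ∀ m m', ∑ j, σ (i m j) * ψ m' j = θ * h m m' := by
    intro m m'
    let L : M →+ S := { toFun := fun x => h x m', map_zero' := zero_left H m',
                        map_add' := fun x y => H.1 m' x y }
    have h1 : m = ∑ j, i m j • p (Pi.single j 1) := by
      have h2 : p (i m) = m := LinearMap.congr_fun hpi m
      conv_lhs => rw [← h2]
      conv_lhs => rw [pi_eq_sum_univ' (i m)]
      simp [map_sum]
    have h3 : h m m' = ∑ j, σ (i m j) * h (p (Pi.single j 1)) m' := by
      conv_lhs => rw [h1]
      change L _ = _
      rw [map_sum]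
      exact Finset.sum_congr rfl fun j _ => H.2.2.1 _ _ _
    rw [h3, Finset.mul_sum]
    exact Finset.sum_congr rfl fun j _ => by simp only [ψ, LinearMap.coe_mk, AddHom.coe_mk]; ring
  refine ⟨n, i.prod ψ, fun m m' => ?_⟩
  have k1 := key m m'
  have k2 := congrArg σ (key m' m)
  simp only [map_sum, map_mul, hσ, ← H.2.2.2.2] at k2
  change ∑ x, (σ (i m x) * ψ m' x + σ (ψ m x) * i m' x) = h m m'
  rw [Finset.sum_add_distrib]
  have k3 : ∑ x, σ (ψ m x) * i m' x = σ θ * h m m' := by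
    rw [← k2]; exact Finset.sum_congr rfl fun j _ => by ring
  rw [k1, k3, ← add_mul, hθ, one_mul]

theorem complement (K : IsHermitianForm σ k) (H : IsHermitianForm σ h) (hreg : IsRegularForm h)
    (j : M →ₗ[S] N) (hj : ∀ m m', k (j m) (j m') = h m m') :
    ∃ W : Submodule S N, Isom (psum h (fun x y : W => k x y)) k := by
  let W : Submodule S N :=
    { carrier := {v | ∀ m, k v (j m) = 0}
      add_mem' := fun {a b} ha hb m => by rw [K.1, ha, hb, add_zero]
      zero_mem' := fun m => zero_left K _
      smul_mem' := fun c x hx m => by rw [K.2.2.1, hx, mul_zero] }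
  have hW : ∀ (w : W) m, k (w : N) (j m) = 0 := fun w m => w.2 m
  have hW' : ∀ (w : W) m, k (j m) (w : N) = 0 := fun w m => by
    rw [K.2.2.2.2 (w : N) (j m), hW, map_zero]
  let T : (M × W) →ₗ[S] N := j.coprod W.subtype
  have hT : ∀ p, T p = j p.1 + p.2 := fun p => by simp [T]
  have hinj : Function.Injective T := by
    rw [injective_iff_map_eq_zero]
    rintro ⟨m, w⟩ h0
    rw [hT] at h0
    have hm : m = 0 := by
      apply hreg.1
      intro x
      have := zero_left K (j x)
      rw [← h0, K.1, hj, hW, add_zero] at this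
      rw [this, zero_left H]
    subst hm
    simp at h0
    simp [h0]
  have hsurj : Function.Surjective T := by
    intro v
    let φ : M →ₗ[S] S :=
      { toFun := fun x => k v (j x)
        map_add' := fun x y => by rw [map_add, K.2.1]
        map_smul' := fun s x => by rw [map_smul, K.2.2.2.1]; simp [mul_comm] }
    obtain ⟨m, hm⟩ := hreg.2 φ
    refine ⟨(m, ⟨v - j m, fun x => ?_⟩), ?_⟩
    · have := hm x
      rw [sub_eq_add_neg, K.1, neg_left K, hj, this]
      simp [φ]
    · rw [hT]; simp
  refine ⟨W, LinearEquiv.ofBijective T ⟨hinj, hsurj⟩, fun p q => ?_⟩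
  change k (T p) (T q) = _
  rw [hT, hT]
  simp [psum, K.1, K.2.1, hj, hW, hW']

end

section
variable {R S : Type u} [CommRing R] [CommRing S] [Algebra R S]

theorem rank_lemma (hrank2 : HasConstantRank R S 2) (𝔪 : Ideal R) (hm : 𝔪.IsMaximal) :
    ¬ ∀ x : S, ∃ r : R, x - algebraMap R S r ∈ 𝔪.map (algebraMap R S) := by
  intro hall
  obtain ⟨l⟩ := hrank2 𝔪 hm.isPrime
  let A := Localization.AtPrime 𝔪
  let κ := IsLocalRing.ResidueField A
  let φ : S → Fin 2 → κ := fun x i =>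
    IsLocalRing.residue A (l (LocalizedModule.mkLinearMap 𝔪.primeCompl S x) i)
  let c : R → κ := fun r => IsLocalRing.residue A (algebraMap R A r)
  have hadd : ∀ x y, φ (x + y) = φ x + φ y := by
    intro x y; ext i; simp only [φ, map_add, Pi.add_apply]
  have hsm : ∀ (r : R) x i, φ (r • x) i = c r * φ x i := by
    intro r x i
    simp only [φ, c, map_smul]
    rw [← algebraMap_smul (Localization 𝔪.primeCompl) r (LocalizedModule.mkLinearMap 𝔪.primeCompl S x),
      map_smul, Pi.smul_apply, smul_eq_mul, map_mul]
  have hc0 : ∀ r ∈ 𝔪, c r = 0 := by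
    intro r hr
    simp only [c]
    rw [IsLocalRing.residue_eq_zero_iff]
    exact (IsLocalization.AtPrime.to_map_mem_maximal_iff A 𝔪 r).2 hr
  have hc1 : ∀ r ∉ 𝔪, c r ≠ 0 := by
    intro r hr h0
    simp only [c] at h0
    rw [IsLocalRing.residue_eq_zero_iff] at h0
    exact hr ((IsLocalization.AtPrime.to_map_mem_maximal_iff A 𝔪 r).1 h0)
  have h0 : φ 0 = 0 := by ext i; simp [φ]
  have hker : ∀ x ∈ 𝔪.map (algebraMap R S), φ x = 0 := by
    intro x hx
    rw [Ideal.map] at hx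
    suffices h : ∀ a, φ (a * x) = 0 by simpa using h 1
    induction hx using Submodule.span_induction with
    | mem x hx =>
      obtain ⟨r, hr, rfl⟩ := hx
      intro a
      ext i
      rw [mul_comm, ← Algebra.smul_def, hsm, hc0 r hr]; simp
    | zero => simpa using h0
    | add x y _ _ hx hy => intro a; rw [mul_add, hadd, hx, hy, add_zero]
    | smul a x _ hx => intro b; rw [smul_eq_mul, ← mul_assoc]; exact hx _
  have hone : ∀ x, ∃ a, ∀ i, φ x i = a * φ 1 i := by
    intro x
    obtain ⟨r, hr⟩ := hall x
    refine ⟨c r, fun i => ?_⟩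
    have h1 := hker _ hr
    have h2 := hadd (x - algebraMap R S r) (algebraMap R S r)
    rw [h1, sub_add_cancel, zero_add, Algebra.algebraMap_eq_smul_one] at h2
    rw [h2, hsm]
  have hsurj : ∀ i : Fin 2, ∃ x, φ x i ≠ 0 ∧ ∀ j, j ≠ i → φ x j = 0 := by
    intro i
    obtain ⟨⟨x, s⟩, hx⟩ := IsLocalizedModule.surj 𝔪.primeCompl
      (LocalizedModule.mkLinearMap 𝔪.primeCompl S) (l.symm (Pi.single i 1))
    have hx' : ∀ j, φ x j = c s * IsLocalRing.residue A ((Pi.single i 1 : Fin 2 → A) j) := by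
      intro j
      simp only [φ, c]
      rw [← hx, Submonoid.smul_def]
      rw [← algebraMap_smul (Localization 𝔪.primeCompl) (s : R) (l.symm (Pi.single i 1)),
        map_smul, Pi.smul_apply, smul_eq_mul, map_mul, LinearEquiv.apply_symm_apply]
    refine ⟨x, ?_, ?_⟩
    · rw [hx']; simpa using hc1 s s.2
    · intro j hj; rw [hx']; simp [hj]
  obtain ⟨x, hx0, hx1⟩ := hsurj 0
  obtain ⟨y, hy0, hy1⟩ := hsurj 1
  obtain ⟨a, ha⟩ := hone x
  obtain ⟨b, hb⟩ := hone y
  have e1 := hx1 1 (by decide)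
  rw [ha] at hx0 e1
  rw [hb] at hy0
  have := left_ne_zero_of_mul hx0
  have := right_ne_zero_of_mul hy0
  simp_all

theorem sep_aux (k K : Type*) [Field k] [Field K] [Algebra k K] [Algebra.IsSeparable k K]
    (y : K) (r n : k) (hry : algebraMap k K r = y + y) (hny : algebraMap k K n = y * y) :
    ∃ z, algebraMap k K z = y := by
  let q : Polynomial (k) := Polynomial.X ^ 2 -
    Polynomial.C (r) * Polynomial.X + Polynomial.C (n)
  have hq0 : Polynomial.aeval y q = 0 := by
    simp only [q, map_add, map_sub, map_mul, map_pow, Polynomial.aeval_X, Polynomial.aeval_C,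
      hry, hny]
    ring
  have hqm : q.map (algebraMap (k) (K)) = (Polynomial.X - Polynomial.C y) ^ 2 := by
    simp only [q, Polynomial.map_add, Polynomial.map_sub, Polynomial.map_mul, Polynomial.map_pow,
      Polynomial.map_X, Polynomial.map_C, hry, hny, Polynomial.C_add, Polynomial.C_mul]
    ring
  have hsepy : (minpoly (k) y).Separable := Algebra.IsSeparable.isSeparable k y
  have hdvd := Polynomial.map_dvd (algebraMap (k) (K)) (minpoly.dvd _ _ hq0)
  rw [hqm] at hdvd
  have hsq := (hsepy.map (f := algebraMap (k) (K))).squarefree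
  have hdvd1 := (hsq.dvd_pow_iff_dvd two_ne_zero).1 hdvd
  have hdeg := Polynomial.natDegree_le_of_dvd hdvd1 (Polynomial.X_sub_C_ne_zero y)
  rw [Polynomial.natDegree_map, Polynomial.natDegree_X_sub_C] at hdeg
  have hint : IsIntegral (k) y := Algebra.IsIntegral.isIntegral y
  have hpos := minpoly.natDegree_pos hint
  exact (minpoly.natDegree_eq_one_iff).1 (le_antisymm hdeg hpos)

theorem unram (hetale : Algebra.Etale R S) [Module.Finite R S]
    (hrank2 : HasConstantRank R S 2)
    (σ : S →ₐ[R] S)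
    (hσtrace : ∀ s : S, ∃ r : R, s + σ s = algebraMap R S r)
    (hσnorm : ∀ s : S, ∃ r : R, s * σ s = algebraMap R S r)
    (𝔪 : Ideal R) (hm : 𝔪.IsMaximal) (P : Ideal S) (hP : P.IsMaximal)
    (hmP : 𝔪.map (algebraMap R S) ≤ P) : ∃ t, t - σ t ∉ P := by
  by_contra! hall
  have hcm : ∀ r, algebraMap R S r ∈ P → r ∈ 𝔪 := by
    intro r hr
    have : 𝔪 = P.comap (algebraMap R S) := hm.eq_of_le (Ideal.comap_ne_top _ hP.ne_top)
      (Ideal.map_le_iff_le_comap.1 hmP)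
    rw [this]; exact hr
  have hPm : P = 𝔪.map (algebraMap R S) := by
    refine le_antisymm ?_ hmP
    intro x hx
    have hσx : σ x ∈ P := by
      have := P.sub_mem hx (hall x); simpa using this
    obtain ⟨r, hr⟩ := hσtrace x
    obtain ⟨n, hn⟩ := hσnorm x
    have h1 : r ∈ 𝔪 := hcm r (hr ▸ P.add_mem hx hσx)
    have h2 : n ∈ 𝔪 := hcm n (hn ▸ P.mul_mem_left _ hσx)
    have hrad := Algebra.FormallyUnramified.isRadical_map_isMaximal (B := S) (p := 𝔪)
    apply hrad
    refine ⟨2, ?_⟩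
    have : x ^ 2 = x * algebraMap R S r - algebraMap R S n := by rw [← hr, ← hn]; ring
    rw [this]
    exact Ideal.sub_mem _ (Ideal.mul_mem_left _ _ (Ideal.mem_map_of_mem _ h1))
      (Ideal.mem_map_of_mem _ h2)
  apply rank_lemma hrank2 𝔪 hm
  subst hPm
  intro x
  let : Field (R ⧸ 𝔪) := Ideal.Quotient.field 𝔪
  let : Field (S ⧸ 𝔪.map (algebraMap R S)) := Ideal.Quotient.field _
  have : Algebra.FormallyUnramified (R ⧸ 𝔪) (S ⧸ 𝔪.map (algebraMap R S)) := .of_restrictScalars R _ _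
  have : Module.Finite (R ⧸ 𝔪) (S ⧸ 𝔪.map (algebraMap R S)) := .of_restrictScalars_finite R _ _
  have hsep : Algebra.IsSeparable (R ⧸ 𝔪) (S ⧸ 𝔪.map (algebraMap R S)) :=
    Algebra.FormallyUnramified.isSeparable _ _
  obtain ⟨r, hr⟩ := hσtrace x
  obtain ⟨n, hn⟩ := hσnorm x
  let I := 𝔪.map (algebraMap R S)
  let y : S ⧸ I := Ideal.Quotient.mk I x
  have hσx : Ideal.Quotient.mk I (σ x) = y := ((Ideal.Quotient.eq).2 (hall x)).symm
  have hry : algebraMap (R ⧸ 𝔪) (S ⧸ I) (Ideal.Quotient.mk 𝔪 r) = y + y := by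
    rw [Ideal.Quotient.algebraMap_quotient_map_quotient, ← hr, map_add, hσx]
  have hny : algebraMap (R ⧸ 𝔪) (S ⧸ I) (Ideal.Quotient.mk 𝔪 n) = y * y := by
    rw [Ideal.Quotient.algebraMap_quotient_map_quotient, ← hn, map_mul, hσx]
  obtain ⟨z, hz⟩ := sep_aux (R ⧸ 𝔪) (S ⧸ I) y _ _ hry hny
  obtain ⟨w, rfl⟩ := Ideal.Quotient.mk_surjective z
  refine ⟨w, ?_⟩
  rw [Ideal.Quotient.algebraMap_quotient_map_quotient] at hz
  exact (Ideal.Quotient.eq).1 hz.symm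

theorem exists_over (hrank2 : HasConstantRank R S 2) (𝔪 : Ideal R) (hm : 𝔪.IsMaximal) :
    ∃ P : Ideal S, P.IsMaximal ∧ 𝔪.map (algebraMap R S) ≤ P := by
  apply Ideal.exists_le_maximal
  intro h
  apply rank_lemma hrank2 𝔪 hm
  intro x
  exact ⟨0, by rw [h]; trivial⟩

theorem exists_theta (hetale : Algebra.Etale R S) [Module.Finite R S]
    (hrank2 : HasConstantRank R S 2)
    (σ : S →ₐ[R] S)
    (hσtrace : ∀ s : S, ∃ r : R, s + σ s = algebraMap R S r)
    (hσnorm : ∀ s : S, ∃ r : R, s * σ s = algebraMap R S r) : ∃ θ : S, θ + σ θ = 1 := by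
  let T : Ideal R :=
    { carrier := {r | ∃ s : S, s + σ s = algebraMap R S r}
      add_mem' := by
        rintro a b ⟨s, hs⟩ ⟨t, ht⟩
        exact ⟨s + t, by rw [map_add, map_add, ← hs, ← ht]; ring⟩
      zero_mem' := ⟨0, by simp⟩
      smul_mem' := by
        rintro c a ⟨s, hs⟩
        refine ⟨c • s, ?_⟩
        rw [map_smul, ← smul_add, hs, Algebra.smul_def, smul_eq_mul, map_mul] }
  have hT : T = ⊤ := by
    by_contra hne
    obtain ⟨𝔪, hm, hTm⟩ := Ideal.exists_le_maximal T hne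
    obtain ⟨P, hP, hmP⟩ := exists_over hrank2 𝔪 hm
    obtain ⟨t, ht⟩ := unram hetale hrank2 σ hσtrace hσnorm 𝔪 hm P hP hmP
    have key : ∀ s, s + σ s ∈ P := by
      intro s
      obtain ⟨r, hr⟩ := hσtrace s
      rw [hr]
      exact hmP (Ideal.mem_map_of_mem _ (hTm ⟨s, hr⟩))
    apply ht
    have h2 := P.mul_mem_left (σ t) (key 1)
    have := P.sub_mem (key t) h2
    simp only [map_one] at this
    convert this using 1
    ring
  obtain ⟨θ, hθ⟩ : (1 : R) ∈ T := hT ▸ Submodule.mem_top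
  exact ⟨θ, by simpa using hθ⟩

theorem local_split (σ : S →ₐ[R] S) (P Q : Ideal S) (hP : P.IsMaximal) (hQ : Q.IsMaximal)
    (hPQ : ∀ x, σ x ∈ P ↔ x ∈ Q) (hQP : ∀ x, σ x ∈ Q ↔ x ∈ P)
    (θ ε α β γ ν g a b : S) (hε1 : 1 - ε ∈ P) (hε2 : ε ∈ Q)
    (h1 : γ + α * b + β * a = 1) (h2 : ν + σ α * β + α * σ β = 0) (hα : α ∈ Q)
    (h3 : α ∈ P → β ∉ P ∧ β ∈ Q) :
    ∃ s r t : S, ∀ y, y = (α - (σ s * γ + σ r * ν) -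
        (θ * (s * σ s * g + σ s * r * γ + σ r * s * σ γ + r * σ r * ν) + t - σ t) * β) →
        y ∉ P ∧ y ∉ Q := by
  have hσε1 : σ ε ∈ P := (hPQ _).2 hε2
  have hσε2 : 1 - σ ε ∈ Q := by
    have := (hQP _).2 hε1
    simpa using this
  let fP := Ideal.Quotient.mk P
  let fQ := Ideal.Quotient.mk Q
  have p : ∀ {a}, fP a = 0 ↔ a ∈ P := Ideal.Quotient.eq_zero_iff_mem
  have q : ∀ {a}, fQ a = 0 ↔ a ∈ Q := Ideal.Quotient.eq_zero_iff_mem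
  have e1 : fP ε = 1 := by
    have := p.2 hε1
    rw [map_sub, map_one, sub_eq_zero] at this
    exact this.symm
  have e2 : fQ ε = 0 := q.2 hε2
  have e3 : fP (σ ε) = 0 := p.2 hσε1
  have e4 : fQ (σ ε) = 1 := by
    have := q.2 hσε2
    rw [map_sub, map_one, sub_eq_zero] at this
    exact this.symm
  have eα : fQ α = 0 := q.2 hα
  simp only [← p, ← q] at h3 ⊢
  change fP α = 0 → fP β ≠ 0 ∧ fQ β = 0 at h3
  change ∃ s r t : S, ∀ y, y = _ → fP y ≠ 0 ∧ fQ y ≠ 0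
  have h1Q := congrArg fQ h1
  simp only [map_add, map_mul, map_one, eα, zero_mul, add_zero] at h1Q
  by_cases hαP : fP α = 0
  · obtain ⟨hb1, hb2⟩ := h3 hαP
    refine ⟨ε, 0, ε, ?_⟩
    rintro y rfl
    constructor
    · simp [hαP, e1, e3, hb1]
    · rw [hb2] at h1Q
      have : fQ γ = 1 := by simpa using h1Q
      have : Nontrivial (S ⧸ Q) := Ideal.Quotient.nontrivial_iff.2 hQ.ne_top
      have hg : fQ γ = 1 := by simpa using h1Q
      simp [eα, e2, e4, hb2, hg]
  by_cases hγ : fQ γ = 0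
  · by_cases hν : fQ ν = 0
    · exfalso
      have h2Q := congrArg fQ h2
      have hσα : fQ (σ α) ≠ 0 := by
        intro h
        exact hαP (p.2 ((hQP α).1 (q.1 h)))
      have : (Q : Ideal S).IsPrime := hQ.isPrime
      have : Nontrivial (S ⧸ Q) := Ideal.Quotient.nontrivial_iff.2 hQ.ne_top
      simp [hν, eα, hσα] at h2Q
      simp [hγ, h2Q] at h1Q
    · refine ⟨0, ε, 0, ?_⟩
      rintro y rfl
      constructor
      · simp [hαP, e1, e3]
      · simp [eα, e2, e4, hν]
  · refine ⟨ε, 0, 0, ?_⟩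
    rintro y rfl
    constructor
    · simp [hαP, e1, e3]
    · simp [eα, e2, e4, hγ]

theorem local_exists (σ : S →ₐ[R] S) (hσ : ∀ s, σ (σ s) = s)
    (P : Ideal S) (hP : P.IsMaximal) (hδ : ∃ t, t - σ t ∉ P)
    (θ α β γ ν g a b : S)
    (h1 : γ + α * b + β * a = 1) (h2 : ν + σ α * β + α * σ β = 0) :
    ∃ s r t : S, ∀ y, y = (α - (σ s * γ + σ r * ν) -
        (θ * (s * σ s * g + σ s * r * γ + σ r * s * σ γ + r * σ r * ν) + t - σ t) * β) →
        y ∉ P ∧ σ y ∉ P := by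
  let e : S ≃+* S := RingEquiv.ofRingHom σ.toRingHom σ.toRingHom
    (by ext x; exact hσ x) (by ext x; exact hσ x)
  let Q : Ideal S := P.comap e
  have hQ : Q.IsMaximal := Ideal.comap_isMaximal_of_equiv e
  have hPQ : ∀ x, σ x ∈ P ↔ x ∈ Q := fun x => Iff.rfl
  have hQP : ∀ x, σ x ∈ Q ↔ x ∈ P := fun x => by rw [← hPQ, hσ]
  simp only [hPQ]
  have unim : ∀ (I : Ideal S), I.IsMaximal → α ∈ I → β ∈ I → γ ∉ I := by
    intro I hI x1 x2 x3
    apply hI.ne_top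
    rw [Ideal.eq_top_iff_one, ← h1]
    exact I.add_mem (I.add_mem x3 (I.mul_mem_right _ x1)) (I.mul_mem_right _ x2)
  by_cases c1 : α ∉ P ∧ α ∉ Q
  · exact ⟨0, 0, 0, by rintro y rfl; simpa using c1⟩
  by_cases c2 : (α ∈ P ∧ α ∈ Q) ∧ (β ∈ P ∧ β ∈ Q)
  · obtain ⟨⟨a1, a2⟩, b1, b2⟩ := c2
    refine ⟨1, 0, 0, ?_⟩
    have gen : ∀ (I : Ideal S), I.IsMaximal → α ∈ I → β ∈ I →
      (α - (σ 1 * γ + σ 0 * ν) -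
        (θ * (1 * σ 1 * g + σ 1 * 0 * γ + σ 0 * 1 * σ γ + 0 * σ 0 * ν) + 0 - σ 0) * β) ∉ I := by
      intro I hI x1 x2 x3
      apply unim I hI x1 x2
      have := I.sub_mem (I.sub_mem x1 x3) (I.mul_mem_left (θ * g) x2)
      simp only [map_one, map_zero] at this
      convert this using 1
      ring
    rintro y rfl
    exact ⟨gen P hP a1 b1, gen Q hQ a2 b2⟩
  by_cases hPe : P = Q
  · obtain ⟨t, ht⟩ := hδ
    rw [← hPe] at c1 c2 ⊢
    simp only [and_self, not_not] at c1 c2 ⊢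
    have hb : β ∉ P := fun h => c2 ⟨c1, h⟩
    refine ⟨0, 0, t, ?_⟩
    rintro y rfl hy
    have := P.sub_mem c1 hy
    have h3 : (t - σ t) * β ∈ P := by
      convert this using 1
      simp only [map_zero]
      ring
    rcases hP.isPrime.mem_or_mem h3 with h | h
    · exact ht h
    · exact hb h
  have hsup : P ⊔ Q = ⊤ := Ideal.IsMaximal.coprime_of_ne hP hQ hPe
  obtain ⟨x, hx, ε, hε, hxε⟩ := Submodule.mem_sup.1 (hsup ▸ Submodule.mem_top : (1 : S) ∈ P ⊔ Q)
  have hε1 : 1 - ε ∈ P := by rw [← hxε]; simpa using hx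
  have hx1 : 1 - x ∈ Q := by rw [← hxε]; simpa using hε
  have hδP : ε - σ ε ∉ P := by
    intro h
    have h3 : σ ε ∈ P := (hPQ _).2 hε
    apply hP.ne_top
    rw [Ideal.eq_top_iff_one]
    have := P.add_mem (P.add_mem hε1 h) h3
    simpa using this
  have hδQ : ε - σ ε ∉ Q := by
    intro h
    apply hδP
    have h3 : σ (ε - σ ε) ∈ P := (hPQ _).2 h
    rw [map_sub, hσ] at h3
    simpa using P.neg_mem h3
  by_cases c3 : (α ∈ P ∧ α ∈ Q) ∧ (β ∉ P ∧ β ∉ Q)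
  · obtain ⟨⟨a1, a2⟩, b1, b2⟩ := c3
    refine ⟨0, 0, ε, ?_⟩
    have gen : ∀ (I : Ideal S), I.IsMaximal → α ∈ I → β ∉ I → ε - σ ε ∉ I →
      (α - (σ 0 * γ + σ 0 * ν) -
        (θ * (0 * σ 0 * g + σ 0 * 0 * γ + σ 0 * 0 * σ γ + 0 * σ 0 * ν) + ε - σ ε) * β) ∉ I := by
      intro I hI x1 x2 x4 x3
      have := I.sub_mem x1 x3
      have h3 : (ε - σ ε) * β ∈ I := by
        convert this using 1
        simp only [map_zero]
        ring
      rcases hI.isPrime.mem_or_mem h3 with h | h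
      · exact x4 h
      · exact x2 h
    rintro y rfl
    exact ⟨gen P hP a1 b1 hδP, gen Q hQ a2 b2 hδQ⟩
  by_cases hαQ : α ∈ Q
  · by_cases hx : α ∈ P → β ∉ P ∧ β ∈ Q
    · exact local_split σ P Q hP hQ hPQ hQP θ ε α β γ ν g a b hε1 hε h1 h2 hαQ hx
    · have hαP : α ∈ P := by tauto
      obtain ⟨s, r, t, h⟩ := local_split σ Q P hQ hP hQP hPQ θ x α β γ ν g a b hx1 (by assumption)
        h1 h2 hαP (by tauto)
      exact ⟨s, r, t, fun y hy => (h y hy).symm⟩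
  · obtain ⟨s, r, t, h⟩ := local_split σ Q P hQ hP hQP hPQ θ x α β γ ν g a b hx1 (by assumption)
        h1 h2 (by tauto) (by tauto)
    exact ⟨s, r, t, fun y hy => (h y hy).symm⟩

theorem lg_fintype (hR : IsLGRing R) (ι : Type) [Fintype ι] [Nonempty ι] (f : MvPolynomial ι R)
    (hf : ∀ 𝔪 : Ideal R, 𝔪.IsMaximal → ∃ u : ι → R, MvPolynomial.eval u f ∉ 𝔪) :
    ∃ u : ι → R, IsUnit (MvPolynomial.eval u f) := by
  let e := Fintype.equivFin ι
  obtain ⟨u, hu⟩ := hR (Fintype.card ι) Fintype.card_pos (MvPolynomial.rename e f) (by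
    intro 𝔪 hm
    obtain ⟨u, hu⟩ := hf 𝔪 hm
    refine ⟨fun i => Ideal.Quotient.mk 𝔪 (u (e.symm i)), ?_⟩
    let : Field (R ⧸ 𝔪) := Ideal.Quotient.field 𝔪
    have h1 : MvPolynomial.eval (fun i => Ideal.Quotient.mk 𝔪 (u (e.symm i)))
        (MvPolynomial.map (Ideal.Quotient.mk 𝔪) (MvPolynomial.rename e f)) =
        Ideal.Quotient.mk 𝔪 (MvPolynomial.eval u f) := by
      rw [MvPolynomial.eval_map, MvPolynomial.eval₂_rename, MvPolynomial.eval₂_comp]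
      congr 1
      ext i
      simp
    rw [h1, isUnit_iff_ne_zero, Ne, Ideal.Quotient.eq_zero_iff_mem]
    exact hu)
  refine ⟨u ∘ e, ?_⟩
  rwa [MvPolynomial.eval_rename] at hu

theorem lg_norm (hR : IsLGRing R) (hrank2 : HasConstantRank R S 2)
    (σ : S →ₐ[R] S) (hσ : ∀ s, σ (σ s) = s)
    (hσtrace : ∀ s : S, ∃ r : R, s + σ s = algebraMap R S r)
    {θ : S} (hθ : θ + σ θ = 1)
    (ι : Type) [Fintype ι] [Nonempty ι] (f : MvPolynomial ι S)
    (hf : ∀ P : Ideal S, P.IsMaximal → (P.comap (algebraMap R S)).IsMaximal →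
      ∃ u : ι → R, ∀ y, y = MvPolynomial.eval (fun i => algebraMap R S (u i)) f →
        y ∉ P ∧ σ y ∉ P) :
    ∃ u : ι → R, IsUnit (MvPolynomial.eval (fun i => algebraMap R S (u i)) f) := by
  have hfix : ∀ x, σ x = x → x ∈ Set.range (algebraMap R S) := by
    intro x hx
    obtain ⟨r, hr⟩ := hσtrace (x * θ)
    refine ⟨r, ?_⟩
    rw [← hr, map_mul, hx, ← mul_add, hθ, mul_one]
  let f' := MvPolynomial.map σ.toRingHom f
  have hff : MvPolynomial.map σ.toRingHom (f * f') = f * f' := by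
    have : MvPolynomial.map σ.toRingHom f' = f := by
      simp only [f', MvPolynomial.map_map]
      convert MvPolynomial.map_id f
      ext x; exact hσ x
    rw [map_mul, this, mul_comm]
  obtain ⟨G, hG⟩ : f * f' ∈ Set.range (MvPolynomial.map (σ := ι) (algebraMap R S)) := by
    rw [MvPolynomial.mem_range_map_iff_coeffs_subset]
    intro c hc
    obtain ⟨d, -, rfl⟩ := MvPolynomial.mem_coeffs_iff.1 hc
    apply hfix
    conv_rhs => rw [← hff]
    rw [MvPolynomial.coeff_map]
    rfl
  have hGe : ∀ u : ι → R, algebraMap R S (MvPolynomial.eval u G) =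
      MvPolynomial.eval (fun i => algebraMap R S (u i)) f *
      σ (MvPolynomial.eval (fun i => algebraMap R S (u i)) f) := by
    intro u
    have h1 : algebraMap R S (MvPolynomial.eval u G) =
        MvPolynomial.eval (fun i => algebraMap R S (u i)) (MvPolynomial.map (algebraMap R S) G) := by
      exact (MvPolynomial.map_eval (algebraMap R S) u G).symm ▸ rfl
    have h2 : MvPolynomial.eval (fun i => algebraMap R S (u i)) f' =
        σ (MvPolynomial.eval (fun i => algebraMap R S (u i)) f) := by
      have h3 := MvPolynomial.map_eval σ.toRingHom (fun i => algebraMap R S (u i)) f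
      have h4 : (σ.toRingHom : S → S) ∘ (fun i => algebraMap R S (u i)) =
        (fun i => algebraMap R S (u i)) := by
        ext i; exact σ.commutes (u i)
      rw [h4] at h3
      exact h3.symm
    rw [h1, hG, map_mul, h2]
  obtain ⟨u, hu⟩ := lg_fintype hR ι G (by
    intro 𝔪 hm
    obtain ⟨P, hP, hmP⟩ := exists_over hrank2 𝔪 hm
    have hc : 𝔪 = P.comap (algebraMap R S) := hm.eq_of_le (Ideal.comap_ne_top _ hP.ne_top)
      (Ideal.map_le_iff_le_comap.1 hmP)
    obtain ⟨u, hu⟩ := hf P hP (hc ▸ hm)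
    refine ⟨u, fun hmem => ?_⟩
    have h1 := hmP (Ideal.mem_map_of_mem (algebraMap R S) hmem)
    rw [hGe] at h1
    obtain ⟨h2, h3⟩ := hu _ rfl
    rcases hP.isPrime.mem_or_mem h1 with h | h
    · exact h2 h
    · exact h3 h)
  refine ⟨u, ?_⟩
  have := hu.map (algebraMap R S)
  rw [hGe] at this
  exact isUnit_of_mul_isUnit_left this

theorem unit_exists (hR : IsLGRing R) (hetale : Algebra.Etale R S) [Module.Finite R S]
    (hrank2 : HasConstantRank R S 2)
    (σ : S →ₐ[R] S) (hσ : ∀ s, σ (σ s) = s)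
    (hσtrace : ∀ s : S, ∃ r : R, s + σ s = algebraMap R S r)
    (hσnorm : ∀ s : S, ∃ r : R, s * σ s = algebraMap R S r)
    {θ : S} (hθ : θ + σ θ = 1)
    (α β γ ν g a b : S) (h1 : γ + α * b + β * a = 1) (h2 : ν + σ α * β + α * σ β = 0) :
      ∃ s r t : S, IsUnit (α - (σ s * γ + σ r * ν) -
        (θ * (s * σ s * g + σ s * r * γ + σ r * s * σ γ + r * σ r * ν) + t - σ t) * β) := by
  rcases subsingleton_or_nontrivial S with hS | hS
  · exact ⟨0, 0, 0, isUnit_of_subsingleton _⟩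
  obtain ⟨n, B, hB⟩ := Module.Finite.exists_fin (R := R) (M := S)
  have hn : Nonempty (Fin n) := by
    by_contra hne
    rw [not_nonempty_iff] at hne
    rw [Set.range_eq_empty, Submodule.span_empty] at hB
    exact absurd hB bot_ne_top
  let X : Fin 3 → MvPolynomial (Fin 3 × Fin n) S := fun j =>
    ∑ i, MvPolynomial.X (j, i) * MvPolynomial.C (B i)
  let Y : Fin 3 → MvPolynomial (Fin 3 × Fin n) S := fun j =>
    ∑ i, MvPolynomial.X (j, i) * MvPolynomial.C (σ (B i))
  let x : (Fin 3 × Fin n → R) → Fin 3 → S := fun u j => ∑ i, algebraMap R S (u (j, i)) * B i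
  have hX : ∀ u j, MvPolynomial.eval (fun i => algebraMap R S (u i)) (X j) = x u j := by
    intro u j; simp [X, x]
  have hY : ∀ u j, MvPolynomial.eval (fun i => algebraMap R S (u i)) (Y j) = σ (x u j) := by
    intro u j; simp [Y, x]
  have hx : ∀ s : S, ∃ c : Fin n → R, ∑ i, algebraMap R S (c i) * B i = s := by
    intro s
    have : s ∈ Submodule.span R (Set.range B) := hB ▸ Submodule.mem_top
    obtain ⟨c, hc⟩ := (Submodule.mem_span_range_iff_exists_fun R).1 this
    exact ⟨c, by simpa [Algebra.smul_def] using hc⟩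
  let f : MvPolynomial (Fin 3 × Fin n) S :=
    MvPolynomial.C α - (Y 0 * MvPolynomial.C γ + Y 1 * MvPolynomial.C ν) -
      (MvPolynomial.C θ * (X 0 * Y 0 * MvPolynomial.C g + Y 0 * X 1 * MvPolynomial.C γ +
        Y 1 * X 0 * MvPolynomial.C (σ γ) + X 1 * Y 1 * MvPolynomial.C ν) + X 2 - Y 2) *
        MvPolynomial.C β
  have hfe : ∀ u, MvPolynomial.eval (fun i => algebraMap R S (u i)) f =
     (α - (σ (x u 0) * γ + σ (x u 1) * ν) -
        (θ * (x u 0 * σ (x u 0) * g + σ (x u 0) * x u 1 * γ + σ (x u 1) * x u 0 * σ γ +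
          x u 1 * σ (x u 1) * ν) + x u 2 - σ (x u 2)) * β) := by
    intro u
    simp only [f, map_add, map_sub, map_mul, MvPolynomial.eval_C, hX, hY]
  obtain ⟨u, hu⟩ := lg_norm hR hrank2 σ hσ hσtrace hθ (Fin 3 × Fin n) f (by
    intro P hP hm
    obtain ⟨s, r, t, h⟩ := local_exists σ hσ P hP
      (unram hetale hrank2 σ hσtrace hσnorm _ hm P hP Ideal.map_comap_le) θ α β γ ν g a b h1 h2
    obtain ⟨cs, hcs⟩ := hx s
    obtain ⟨cr, hcr⟩ := hx r
    obtain ⟨ct, hct⟩ := hx t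
    refine ⟨fun p => ![cs, cr, ct] p.1 p.2, fun y hy => h y ?_⟩
    rw [hy, hfe]
    simp [x, hcs, hcr, hct])
  rw [hfe] at hu
  exact ⟨_, _, _, hu⟩

end
end LGC

/-- (Cancellation of hermitian forms.)  Let `R` be an LG-ring, `S` a
quadratic étale `R`-algebra with standard involution `σ` (the unique `R`-algebra
involution with `s + σ(s) ∈ R·1` and `s·σ(s) ∈ R·1` for all `s`), and `h₁`, `h₂`, `h₃`
hermitian spaces over `(S, σ)`.  If `h₁ ⊥ h₃` and `h₂ ⊥ h₃` are isometric, then `h₁` and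
`h₂` are isometric. -/
theorem lg_ring_hermitian_cancellation
    {R : Type u} [CommRing R] (hR : IsLGRing R)
    (S : Type u) [CommRing S] [Algebra R S]
    (hetale : Algebra.Etale R S) [Module.Finite R S] [Module.Projective R S]
    (hrank2 : HasConstantRank R S 2)
    (σ : S →ₐ[R] S) (hσinv : ∀ s : S, σ (σ s) = s)
    (hσtrace : ∀ s : S, ∃ r : R, s + σ s = algebraMap R S r)
    (hσnorm : ∀ s : S, ∃ r : R, s * σ s = algebraMap R S r)
    (M₁ M₂ M₃ : Type u)
    [AddCommGroup M₁] [Module S M₁] [Module.Finite S M₁] [Module.Projective S M₁]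
    [AddCommGroup M₂] [Module S M₂] [Module.Finite S M₂] [Module.Projective S M₂]
    [AddCommGroup M₃] [Module S M₃] [Module.Finite S M₃] [Module.Projective S M₃]
    (h₁ : M₁ → M₁ → S) (h₂ : M₂ → M₂ → S) (h₃ : M₃ → M₃ → S)
    (hherm₁ : IsHermitianForm σ h₁) (hreg₁ : IsRegularForm h₁)
    (hherm₂ : IsHermitianForm σ h₂) (hreg₂ : IsRegularForm h₂)
    (hherm₃ : IsHermitianForm σ h₃) (hreg₃ : IsRegularForm h₃)
    (hiso : ∃ f : (M₁ × M₃) ≃ₗ[S] (M₂ × M₃), ∀ p q : M₁ × M₃,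
      h₂ (f p).1 (f q).1 + h₃ (f p).2 (f q).2 = h₁ p.1 q.1 + h₃ p.2 q.2) :
    ∃ g : M₁ ≃ₗ[S] M₂, ∀ m m' : M₁, h₂ (g m) (g m') = h₁ m m' := by
  obtain ⟨θ, hθ⟩ := LGC.exists_theta hetale hrank2 σ hσtrace hσnorm
  have hU := LGC.unit_exists hR hetale hrank2 σ hσinv hσtrace hσnorm hθ
  obtain ⟨n, j, hj⟩ := LGC.embed hσinv hθ hherm₃
  obtain ⟨W, hW⟩ := LGC.complement (LGC.herm_hypn hσinv n) hherm₃ hreg₃ j hj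
  have h0 : LGC.Isom (LGC.psum h₁ h₃) (LGC.psum h₂ h₃) := hiso
  have h1 := h0.psum (LGC.Isom.refl (fun x y : W => LGC.hypn σ n x y))
  have e : ∀ {M : Type u} [AddCommGroup M] [Module S M] (h : M → M → S),
      LGC.Isom (LGC.psum (LGC.psum h h₃) (fun x y : W => LGC.hypn σ n x y))
        (LGC.psum h (LGC.hypn σ n)) := fun h =>
    (LGC.psum_assoc _ _ _).trans ((LGC.Isom.refl h).psum hW)
  exact LGC.canc_n hσinv hθ hU hherm₁ hherm₂ n ((e h₁).symm.trans (h1.trans (e h₂)))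
end

section
/- Let R be an LG-ring, let q₁ and q₂ be nonsingular quadratic forms over R, and let q₃ be a regular quadratic form over R. If the orthogonal sums q₁ ⊥ q₃ and q₂ ⊥ q₃ are isometric, then q₁ and q₂ are isometric. -/
open TensorProduct

universe u v

/-- A quadratic form `q` on `M` is nonsingular if for every field `F` which is an
`R`-algebra, the base change `q_F` (the unique quadratic form on `F ⊗_R M` with
`q_F(t ⊗ m) = t² q(m)` whose polar form is the base change of the polar form of `q`)
has trivial radical:  every `z` with `q_F(z) = 0` and `b_{q_F}(z, −) = 0` is zero. -/
def IsNonsingularQF {R : Type u} {M : Type v} [CommRing R] [AddCommGroup M] [Module R M]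
    (q : QuadraticForm R M) : Prop :=
  ∀ (F : Type u) [Field F] [Algebra R F],
    ∀ Q : QuadraticForm F (F ⊗[R] M),
      (∀ (t : F) (m : M), Q (t ⊗ₜ[R] m) = t ^ 2 * algebraMap R F (q m)) →
      (∀ (t t' : F) (m m' : M),
        QuadraticMap.polar Q (t ⊗ₜ[R] m) (t' ⊗ₜ[R] m') =
          t * t' * algebraMap R F (QuadraticMap.polar q m m')) →
      ∀ z : F ⊗[R] M, Q z = 0 → (∀ w : F ⊗[R] M, QuadraticMap.polar Q z w = 0) → z = 0

/-- A quadratic form is regular if its polar adjoint `M → Hom_R(M, R)`, `m ↦ b_q(m, −)`,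
is bijective. -/
def IsRegularQF {R : Type u} {M : Type v} [CommRing R] [AddCommGroup M] [Module R M]
    (q : QuadraticForm R M) : Prop :=
  Function.Bijective ⇑(QuadraticMap.polarBilin q)


namespace LGCancel

open QuadraticMap

/-- A splitting of `Q` as the orthogonal sum of `q` and a hyperbolic plane. -/
structure HSplit {R V M : Type*} [CommRing R] [AddCommGroup V] [Module R V]
    [AddCommGroup M] [Module R M] (Q : QuadraticForm R V) (q : QuadraticForm R M) where
  i : M →ₗ[R] V
  p : V →ₗ[R] M
  e : V
  f : V
  decomp : ∀ x, i (p x) = x - polar Q x f • e - polar Q x e • f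
  pi_eq : ∀ m, p (i m) = m
  p_e : p e = 0
  Qe : Q e = 0
  Qf : Q f = 0
  ef : polar Q e f = 1
  ie : ∀ m, polar Q (i m) e = 0
  if_eq : ∀ m, polar Q (i m) f = 0
  Qi : ∀ m, Q (i m) = q m

/-- The map `x ↦ x - w b(x,a) c`. -/
def tra {R V : Type*} [CommRing R] [AddCommGroup V] [Module R V] (Q : QuadraticForm R V)
    (a c : V) (w : R) : V →ₗ[R] V where
  toFun x := x - (w * polar Q x a) • c
  map_add' x y := by rw [polar_add_left]; module
  map_smul' r x := by rw [polar_smul_left]; simp only [smul_eq_mul, RingHom.id_apply]; module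

section
variable {R V M₁ M₂ : Type*} [CommRing R] [AddCommGroup V] [Module R V]
    [AddCommGroup M₁] [Module R M₁] [AddCommGroup M₂] [Module R M₂]
    {Q : QuadraticForm R V} {q₁ : QuadraticForm R M₁} {q₂ : QuadraticForm R M₂}

/-- the transfer map -/
def transfer (A : HSplit Q q₁) (B : HSplit Q q₂) (v : V) (w₁ w₂ : R) : M₁ →ₗ[R] M₂ :=
  B.p ∘ₗ tra Q B.e v w₂ ∘ₗ tra Q v A.e w₁ ∘ₗ A.i

theorem Q_sub_smul (x c : V) (r : R) : Q (x - r • c) = Q x - r * polar Q x c + r * r * Q c := by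
  have : x - r • c = x + (-r) • c := by module
  rw [this, QuadraticMap.map_add Q, QuadraticMap.map_smul, polar_smul_right]
  simp only [smul_eq_mul]; ring

theorem polar_sub_smul (x c z : V) (r : R) :
    polar Q (x - r • c) z = polar Q x z - r * polar Q c z := by
  rw [polar_sub_left, polar_smul_left, smul_eq_mul]

theorem transfer_spec (A : HSplit Q q₁) (B : HSplit Q q₂) (v : V) (w₁ w₂ : R) (hv : Q v = 0)
    (h₁ : ∀ m : M₁, (w₁ * polar Q A.e v) • m = m)
    (h₂ : ∀ m : M₁, (w₂ * polar Q B.e v) • m = m) (x : M₁) :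
    transfer B A v w₂ w₁ (transfer A B v w₁ w₂ x) = x ∧
      q₂ (transfer A B v w₁ w₂ x) = q₁ x := by
  have hvv : polar Q v v = 0 := by rw [polar_self, hv, smul_zero]
  have hee : polar Q B.e B.e = 0 := by rw [polar_self, B.Qe, smul_zero]
  have hee1 : polar Q A.e A.e = 0 := by rw [polar_self, A.Qe, smul_zero]
  obtain ⟨s₁, hs₁⟩ : ∃ s, s = polar Q A.e v := ⟨_, rfl⟩
  obtain ⟨s₂, hs₂⟩ : ∃ s, s = polar Q B.e v := ⟨_, rfl⟩
  have hs₂' : polar Q v B.e = s₂ := by rw [polar_comm, hs₂]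
  have hs₁' : polar Q v A.e = s₁ := by rw [polar_comm, hs₁]
  rw [← hs₁] at h₁
  rw [← hs₂] at h₂
  have k₁ : ∀ z, (w₁ * s₁) * polar Q (A.i x) z = polar Q (A.i x) z := fun z => by
    rw [← smul_eq_mul, ← polar_smul_left, ← map_smul, h₁]
  have k₂ : ∀ z, (w₂ * s₂) * polar Q (A.i x) z = polar Q (A.i x) z := fun z => by
    rw [← smul_eq_mul, ← polar_smul_left, ← map_smul, h₂]
  obtain ⟨a, ha⟩ : ∃ a, a = w₁ * polar Q (A.i x) v := ⟨_, rfl⟩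
  have ka₁ : (w₁ * s₁) * a = a := by rw [ha]; linear_combination w₁ * k₁ v
  have ka₂ : (w₂ * s₂) * a = a := by rw [ha]; linear_combination w₁ * k₂ v
  obtain ⟨t, ht⟩ : ∃ t, t = A.i x - a • A.e := ⟨_, rfl⟩
  have tv : polar Q t v = 0 := by
    rw [ht, polar_sub_smul, ha, ← hs₁]; linear_combination -k₁ v
  have kt₁ : ∀ z, (w₁ * s₁) * polar Q t z = polar Q t z := fun z => by
    rw [ht, polar_sub_smul]; linear_combination k₁ z - polar Q A.e z * ka₁
  have kt₂ : ∀ z, (w₂ * s₂) * polar Q t z = polar Q t z := fun z => by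
    rw [ht, polar_sub_smul]; linear_combination k₂ z - polar Q A.e z * ka₂
  obtain ⟨c, hc⟩ : ∃ c, c = w₂ * polar Q t B.e := ⟨_, rfl⟩
  have kc₁ : (w₁ * s₁) * c = c := by rw [hc]; linear_combination w₂ * kt₁ B.e
  have kc₂ : (w₂ * s₂) * c = c := by rw [hc]; linear_combination w₂ * kt₂ B.e
  obtain ⟨y, hy⟩ : ∃ y, y = t - c • v := ⟨_, rfl⟩
  have ky₂ : ∀ z, (w₂ * s₂) * polar Q y z = polar Q y z := fun z => by
    rw [hy, polar_sub_smul]; linear_combination kt₂ z - polar Q v z * kc₂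
  have yv : polar Q y v = 0 := by rw [hy, polar_sub_smul, tv, hvv]; ring
  have ye : polar Q y B.e = 0 := by
    rw [hy, polar_sub_smul, hc, hs₂']; linear_combination -kt₂ B.e
  have te : polar Q t A.e = 0 := by rw [ht, polar_sub_smul, A.ie, hee1]; ring
  have yA : polar Q y A.e = - c * s₁ := by
    rw [hy, polar_sub_smul, hs₁', te]; ring
  have hT : transfer A B v w₁ w₂ x = B.p y := by
    simp [transfer, tra, hy, hc, ht, ha]
  have hBy : B.i (B.p y) = y - polar Q y B.f • B.e := by
    rw [B.decomp, ye]; module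
  rw [hT]
  constructor
  · have e1 : tra Q v B.e w₂ (B.i (B.p y)) = y := by
      rw [hBy]
      change y - polar Q y B.f • B.e - (w₂ * polar Q (y - polar Q y B.f • B.e) v) • B.e = y
      rw [polar_sub_smul, yv, ← hs₂]
      have := ky₂ B.f
      have h' : w₂ * (0 - polar Q y B.f * s₂) = - polar Q y B.f := by
        linear_combination -this
      rw [h']; module
    have e2 : tra Q A.e v w₁ y = t := by
      change y - (w₁ * polar Q y A.e) • v = t
      rw [yA]
      have h' : w₁ * (-c * s₁) = -c := by linear_combination -kc₁
      rw [h', hy]; module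
    change A.p (tra Q A.e v w₁ (tra Q v B.e w₂ (B.i (B.p y)))) = x
    rw [e1, e2, ht, map_sub, map_smul, A.p_e, A.pi_eq]; simp
  · rw [← B.Qi, hBy, Q_sub_smul, ye, B.Qe, hy, Q_sub_smul, tv, hv, ht, Q_sub_smul, A.ie, A.Qe, A.Qi]
    ring

theorem HSplit.isometry (A : HSplit Q q₁) (B : HSplit Q q₂) (v : V) (w₁ w₂ : R) (hv : Q v = 0)
    (h₁ : ∀ m : M₁, (w₁ * polar Q A.e v) • m = m)
    (h₂ : ∀ m : M₁, (w₂ * polar Q B.e v) • m = m)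
    (h₃ : ∀ m : M₂, (w₁ * polar Q A.e v) • m = m)
    (h₄ : ∀ m : M₂, (w₂ * polar Q B.e v) • m = m) :
    Nonempty (QuadraticMap.IsometryEquiv q₁ q₂) := by
  refine ⟨⟨LinearEquiv.ofLinearMap (transfer A B v w₁ w₂) (transfer B A v w₂ w₁) ?_ ?_, ?_⟩⟩
  · ext x
    exact (transfer_spec B A v w₂ w₁ hv h₄ h₃ x).1
  · ext x
    exact (transfer_spec A B v w₁ w₂ hv h₁ h₂ x).1
  · intro x
    exact (transfer_spec A B v w₁ w₂ hv h₁ h₂ x).2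

/-- A splitting obtained from an isometry. -/
def HSplit.ofIso (φ : QuadraticMap.IsometryEquiv (q₁.prod (QuadraticForm.dualProd R R)) Q) :
    HSplit Q q₁ where
  i := φ.toLinearEquiv.toLinearMap ∘ₗ LinearMap.inl R M₁ (Module.Dual R R × R)
  p := LinearMap.fst R M₁ (Module.Dual R R × R) ∘ₗ φ.toLinearEquiv.symm.toLinearMap
  e := φ.toLinearEquiv (0, LinearMap.id, 0)
  f := φ.toLinearEquiv (0, 0, 1)
  decomp := by
    intro x
    obtain ⟨⟨m, g, r⟩, rfl⟩ := φ.toLinearEquiv.surjective x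
    have hp : ∀ a b, polar Q (φ.toLinearEquiv a) (φ.toLinearEquiv b) =
        polar (q₁.prod (QuadraticForm.dualProd R R)) a b := fun a b => by
      simp only [polar, ← map_add]; erw [φ.map_app, φ.map_app, φ.map_app]
    rw [hp, hp, ← map_smul, ← map_smul, ← map_sub, ← map_sub]
    simp only [LinearMap.comp_apply, LinearEquiv.coe_coe, LinearEquiv.symm_apply_apply]
    congr 1
    ext <;> simp [polar]
  pi_eq := by intro m; simp
  p_e := by simp
  Qe := by erw [φ.map_app]; simp
  Qf := by erw [φ.map_app]; simp
  ef := by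
    simp only [polar, ← map_add]; erw [φ.map_app, φ.map_app, φ.map_app]; simp
  ie := by
    intro m
    simp only [polar, LinearMap.comp_apply, LinearEquiv.coe_coe, ← map_add]
    erw [φ.map_app, φ.map_app, φ.map_app]; simp
  if_eq := by
    intro m
    simp only [polar, LinearMap.comp_apply, LinearEquiv.coe_coe, ← map_add]
    erw [φ.map_app, φ.map_app, φ.map_app]; simp
  Qi := by
    intro m
    simp only [LinearMap.comp_apply, LinearEquiv.coe_coe]
    erw [φ.map_app]; simp
end

/-- trace idempotent -/
theorem exists_idem (R M : Type*) [CommRing R] [AddCommGroup M] [Module R M] [Module.Finite R M]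
    [Module.Projective R M] : ∃ ε : R, ε * ε = ε ∧ (∀ m : M, ε • m = m) ∧
      ∀ I : Ideal R, (∀ (g : M →ₗ[R] R) (m : M), g m ∈ I) → ε ∈ I := by
  obtain ⟨n, f, g, -, -, hfg⟩ := Module.Finite.exists_comp_eq_id_of_projective R M
  have hm : ∀ m : M, m = ∑ i, g m i • f (Pi.single i 1) := fun m => by
    conv_lhs => rw [← LinearMap.id_apply (R := R) m, ← hfg, LinearMap.comp_apply,
      LinearMap.pi_apply_eq_sum_univ f (g m)]
    refine Finset.sum_congr rfl fun i _ => ?_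
    congr 2
    ext j; simp [Pi.single_apply, eq_comm]
  let T : Ideal R := Ideal.span (Set.range fun ij : Fin n × Fin n => g (f (Pi.single ij.1 1)) ij.2)
  have hT : ∀ i j, g (f (Pi.single i 1)) j ∈ T := fun i j => Ideal.subset_span ⟨(i, j), rfl⟩
  have hid : IsIdempotentElem T := by
    refine le_antisymm Ideal.mul_le_right (Ideal.span_le.2 ?_)
    rintro _ ⟨⟨i, j⟩, rfl⟩
    dsimp only
    have := congrArg (fun z => g z j) (hm (f (Pi.single i 1)))
    simp only [map_sum, map_smul, Finset.sum_apply, Pi.smul_apply, smul_eq_mul] at this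
    rw [this]
    exact Ideal.sum_mem _ fun k _ => Ideal.mul_mem_mul (hT _ _) (hT _ _)
  obtain ⟨ε, hε, hTε⟩ := (Ideal.isIdempotentElem_iff_of_fg T
    (Submodule.fg_span (Set.finite_range _))).1 hid
  have hεT : ∀ t ∈ T, ε * t = t := fun t ht => by
    rw [hTε] at ht
    obtain ⟨s, rfl⟩ := Submodule.mem_span_singleton.1 ht
    rw [smul_eq_mul]
    linear_combination s * hε.eq
  refine ⟨ε, hε, fun m => ?_, fun I hI => ?_⟩
  · have h0 : ∀ i, ε • f (Pi.single i 1) = f (Pi.single i 1) := fun i => by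
      conv_lhs => rw [hm (f (Pi.single i 1))]
      conv_rhs => rw [hm (f (Pi.single i 1))]
      rw [Finset.smul_sum]
      refine Finset.sum_congr rfl fun k _ => ?_
      rw [smul_smul, hεT _ (hT _ _)]
    conv_lhs => rw [hm m]
    conv_rhs => rw [hm m]
    rw [Finset.smul_sum]
    refine Finset.sum_congr rfl fun k _ => ?_
    rw [smul_comm, h0]
  · have : T ≤ I := by
      refine Ideal.span_le.2 ?_
      rintro _ ⟨⟨i, j⟩, rfl⟩
      exact hI (LinearMap.proj j ∘ₗ g) (f (Pi.single i 1))
    exact this (hTε ▸ Submodule.mem_span_singleton_self ε)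

/-- If `(1-ε)` kills `M₁` and `M₁ × W ≃ M₂ × W`, it kills `M₂`. -/
theorem idem_transfer {R M₁ M₂ W : Type*} [CommRing R] [AddCommGroup M₁] [Module R M₁]
    [AddCommGroup M₂] [Module R M₂] [AddCommGroup W] [Module R W] [Module.Finite R W]
    (φ : (M₁ × W) ≃ₗ[R] (M₂ × W)) (ε : R) (hε : ε * ε = ε) (h₁ : ∀ m : M₁, ε • m = m) (m : M₂) :
    ε • m = m := by
  let g : W →ₗ[R] W := (1 - ε) • (LinearMap.snd R M₂ W ∘ₗ φ.toLinearMap ∘ₗ LinearMap.inr R M₁ W)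
    + ε • LinearMap.id
  have hg : ∀ w, g w = (1 - ε) • (φ (0, w)).2 + ε • w := fun w => rfl
  have key : ∀ m w, (1 - ε) • φ (m, w) = φ (0, (1 - ε) • w) := fun m w => by
    rw [← map_smul]; congr 1
    ext
    · simp [sub_smul, h₁]
    · simp
  have hi : (1 - ε) * (1 - ε) = 1 - ε := by linear_combination hε
  have hi0 : (1 - ε) * ε = 0 := by linear_combination -hε
  have hi1 : ε * (1 - ε) = 0 := by linear_combination -hε
  have gkey : ∀ m w, g ((1 - ε) • w) = (1 - ε) • (φ (m, w)).2 := fun m w => by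
    rw [hg, ← key m, Prod.smul_snd, smul_smul, smul_smul, hi, hi1, zero_smul, add_zero]
  have hs : Function.Surjective g := by
    intro y
    obtain ⟨⟨m', w⟩, hw⟩ := φ.surjective (0, y)
    refine ⟨(1 - ε) • w + ε • y, ?_⟩
    rw [map_add, gkey m', hw, map_smul, hg, smul_add, smul_smul, smul_smul, hε, mul_comm ε, hi0,
      zero_smul]
    module
  have hinj := OrzechProperty.injective_of_surjective_endomorphism g hs
  obtain ⟨⟨m', w⟩, hw⟩ := φ.surjective (m, 0)
  have h0 : (1 - ε) • w = 0 := by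
    apply hinj
    rw [gkey m', hw, map_zero, smul_zero]
  have h2 := key m' w
  rw [h0, hw, Prod.mk_zero_zero, map_zero] at h2
  have h3 := congrArg Prod.fst h2
  simp only [Prod.smul_fst, Prod.fst_zero, sub_smul, one_smul] at h3
  exact (sub_eq_zero.1 h3).symm

theorem lin_poly {R : Type*} [CommRing R] {n : ℕ} (l : (Fin n → R) →ₗ[R] R) :
    ∃ p : MvPolynomial (Fin n) R, ∀ x, MvPolynomial.eval x p = l x := by
  refine ⟨∑ i, MvPolynomial.X i * MvPolynomial.C (l fun j => if i = j then 1 else 0), fun x => ?_⟩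
  rw [LinearMap.pi_apply_eq_sum_univ l x]
  simp

theorem quad_poly {R : Type*} [CommRing R] {n : ℕ} (q : QuadraticForm R (Fin n → R)) :
    ∃ p : MvPolynomial (Fin n) R, ∀ x, MvPolynomial.eval x p = q x := by
  obtain ⟨B, rfl⟩ := LinearMap.BilinMap.toQuadraticMap_surjective q
  choose p hp using fun i : Fin n => lin_poly (B fun j => if i = j then 1 else 0)
  refine ⟨∑ i, MvPolynomial.X i * p i, fun x => ?_⟩
  rw [LinearMap.BilinMap.toQuadraticMap_apply]
  conv_rhs => rw [LinearMap.pi_apply_eq_sum_univ B x]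
  simp [hp]

/-- Consequence of nonsingularity that we use. -/
def NZ {R M : Type*} [CommRing R] [AddCommGroup M] [Module R M] (q : QuadraticForm R M) : Prop :=
  ∀ I : Ideal R, I.IsMaximal → (∀ m, q m ∈ I) → ∀ (g : M →ₗ[R] R) (m : M), g m ∈ I

theorem NZ_of_nonsingular {R : Type u} {M : Type v} [CommRing R] [AddCommGroup M] [Module R M]
    (q : QuadraticForm R M) (h : IsNonsingularQF q) : NZ q := by
  intro I hI hq g m
  letI : Field (R ⧸ I) := Ideal.Quotient.field I
  have hq' : ∀ m, algebraMap R (R ⧸ I) (q m) = 0 := fun m => Ideal.Quotient.eq_zero_iff_mem.2 (hq m)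
  have := h (R ⧸ I) 0 (by intro t m; rw [hq']; simp)
    (by
      intro t t' m m'
      have h0 : algebraMap R (R ⧸ I) (polar q m m') = 0 := by
        rw [polar, map_sub, map_sub, hq', hq', hq']; simp
      rw [h0]; simp [polar]) (1 ⊗ₜ m) (by simp) (by simp [polar])
  have h2 := congrArg (TensorProduct.rid R (R ⧸ I) ∘ LinearMap.lTensor (R ⧸ I) g) this
  simp only [Function.comp_apply, LinearMap.lTensor_tmul, TensorProduct.rid_tmul, map_zero] at h2
  rw [Algebra.smul_def, mul_one] at h2
  exact Ideal.Quotient.eq_zero_iff_mem.1 h2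

theorem core {R M₁ M₂ : Type*} [CommRing R] (hR : IsLGRing R)
    [AddCommGroup M₁] [Module R M₁] [AddCommGroup M₂] [Module R M₂]
    [Module.Finite R M₁] [Module.Projective R M₁]
    (q₁ : QuadraticForm R M₁) (q₂ : QuadraticForm R M₂) (hq : NZ q₁)
    (φ : QuadraticMap.IsometryEquiv (q₁.prod (QuadraticForm.dualProd R R))
      (q₂.prod (QuadraticForm.dualProd R R))) :
    Nonempty (QuadraticMap.IsometryEquiv q₁ q₂) := by
  obtain ⟨ε, hε, hε₁, hεI⟩ := exists_idem R M₁
  have hε₂ : ∀ m : M₂, ε • m = m := idem_transfer φ.toLinearEquiv ε hε hε₁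
  let A := HSplit.ofIso φ
  let B := HSplit.ofIso (QuadraticMap.IsometryEquiv.refl (q₂.prod (QuadraticForm.dualProd R R)))
  clear_value A B
  revert A B
  generalize q₂.prod (QuadraticForm.dualProd R R) = Q
  intro A B
  clear φ
  obtain ⟨n, s, hs⟩ := Module.Finite.exists_fin' R M₁
  let S : (Fin (n + 1) → R) →ₗ[R] M₁ := s ∘ₗ LinearMap.funLeft R R Fin.succ
  have hS : Function.Surjective S :=
    hs.comp (LinearMap.funLeft_surjective_of_injective R R _ (Fin.succ_injective n))
  obtain ⟨pl, hpl⟩ := lin_poly ((Q.polarBilin B.e ∘ₗ A.i) ∘ₗ S)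
  obtain ⟨pq, hpq⟩ := quad_poly (q₁.comp S)
  let P : MvPolynomial (Fin (n + 1)) R := MvPolynomial.C (1 - ε) + MvPolynomial.C ε *
    (MvPolynomial.C (polar Q B.e A.f) + pl - MvPolynomial.C (polar Q B.e A.e) * pq)
  have hP : ∀ x, MvPolynomial.eval x P = (1 - ε) + ε * (polar Q B.e A.f +
      polar Q B.e (A.i (S x)) - polar Q B.e A.e * q₁ (S x)) := fun x => by
    simp only [P, map_add, map_sub, map_mul, MvPolynomial.eval_C, hpl, hpq]
    simp
  obtain ⟨x, hx⟩ := hR (n + 1) (by omega) P (by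
    intro I hI
    letI : Field (R ⧸ I) := Ideal.Quotient.field I
    suffices h : ∃ x, MvPolynomial.eval x P ∉ I by
      obtain ⟨x, hx⟩ := h
      refine ⟨fun i => Ideal.Quotient.mk I (x i), ?_⟩
      have : MvPolynomial.eval (fun i => Ideal.Quotient.mk I (x i))
          (MvPolynomial.map (Ideal.Quotient.mk I) P) =
          Ideal.Quotient.mk I (MvPolynomial.eval x P) := by
        rw [MvPolynomial.eval_map, MvPolynomial.eval₂_comp]; rfl
      rw [this]
      exact isUnit_iff_ne_zero.2 fun h0 => hx (Ideal.Quotient.eq_zero_iff_mem.1 h0)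
    by_contra! hcon
    have hp := hI.isPrime
    have hall : ∀ m : M₁, (1 - ε) + ε * (polar Q B.e A.f +
      polar Q B.e (A.i m) - polar Q B.e A.e * q₁ m) ∈ I := fun m => by
      obtain ⟨x, rfl⟩ := hS m
      rw [← hP]; exact hcon x
    have hεI' : ε ∉ I := by
      intro h
      apply hp.ne_top
      rw [Ideal.eq_top_iff_one]
      have := I.add_mem (hall 0) (I.mul_mem_right (1 - (polar Q B.e A.f +
        polar Q B.e (A.i 0) - polar Q B.e A.e * q₁ 0)) h)
      convert this using 1
      ring
    have h1ε : 1 - ε ∈ I := by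
      refine (hp.mem_or_mem (x := ε) ?_).resolve_left hεI'
      have : ε * (1 - ε) = 0 := by linear_combination -hε
      rw [this]; exact I.zero_mem
    have hall' : ∀ m : M₁, polar Q B.e A.f +
      polar Q B.e (A.i m) - polar Q B.e A.e * q₁ m ∈ I := fun m =>
      (hp.mem_or_mem ((Submodule.add_mem_iff_right _ h1ε).1 (hall m))).resolve_left hεI'
    have hα : polar Q B.e A.f ∈ I := by simpa using hall' 0
    have hl : ∀ m : M₁, polar Q B.e (A.i m) - polar Q B.e A.e * q₁ m ∈ I := fun m => by
      have := hall' m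
      rw [add_sub_assoc] at this
      exact (Submodule.add_mem_iff_right _ hα).1 this
    by_cases hβ : polar Q B.e A.e ∈ I
    · apply hp.ne_top
      rw [Ideal.eq_top_iff_one]
      have h1 : ∀ m : M₁, polar Q B.e (A.i m) ∈ I := fun m => by
        have := I.add_mem (hl m) (I.mul_mem_right (q₁ m) hβ)
        simpa using this
      have hd := A.decomp B.f
      have h2 := h1 (A.p B.f)
      rw [hd, polar_sub_right, polar_sub_right, polar_smul_right, polar_smul_right, B.ef,
        smul_eq_mul, smul_eq_mul] at h2
      have h3 := I.add_mem (I.add_mem h2 (I.mul_mem_left (polar Q B.f A.f) hβ))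
        (I.mul_mem_left (polar Q B.f A.e) hα)
      convert h3 using 1
      ring
    · have hb : ∀ m m' : M₁, polar q₁ m m' ∈ I := fun m m' => by
        have h1 := I.sub_mem (I.sub_mem (hl (m + m')) (hl m)) (hl m')
        rw [map_add, polar_add_right, QuadraticMap.map_add q₁] at h1
        refine (hp.mem_or_mem (x := polar Q B.e A.e) ?_).resolve_left hβ
        convert I.neg_mem h1 using 1
        ring
      refine hεI' (hεI I (hq I hI fun m => ?_))
      refine (hp.mem_or_mem (x := polar Q B.e A.e) ?_).resolve_left hβ
      have h2 := hb (A.p B.e) m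
      have h3 : polar Q B.e (A.i m) = polar q₁ (A.p B.e) m := by
        have : polar q₁ (A.p B.e) m = polar Q (A.i (A.p B.e)) (A.i m) := by
          simp only [polar, ← A.Qi, map_add]
        rw [this, A.decomp, polar_sub_smul, polar_sub_smul, polar_comm Q A.e, polar_comm Q A.f,
          A.ie, A.if_eq]
        ring
      have := I.sub_mem h2 (hl m)
      rw [h3] at this
      simpa using this)
  obtain ⟨u, hu⟩ := hx
  rw [hP] at hu
  let v := A.f + A.i (S x) - q₁ (S x) • A.e
  have hQv : Q v = 0 := by
    change Q (A.f + A.i (S x) - q₁ (S x) • A.e) = 0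
    rw [Q_sub_smul, QuadraticMap.map_add Q, A.Qf, A.Qi, A.Qe, polar_add_left, A.ie,
      polar_comm Q A.f A.e, A.ef, polar_comm Q A.f, A.if_eq]
    ring
  have hAv : polar Q A.e v = 1 := by
    change polar Q A.e (A.f + A.i (S x) - q₁ (S x) • A.e) = 1
    rw [polar_sub_right, polar_add_right, A.ef, polar_comm Q A.e (A.i _), A.ie, polar_smul_right,
      polar_self, A.Qe]
    simp
  have hBv : ε * (↑u⁻¹ * polar Q B.e v) = ε := by
    have h1 : polar Q B.e v = polar Q B.e A.f +
      polar Q B.e (A.i (S x)) - polar Q B.e A.e * q₁ (S x) := by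
      change polar Q B.e (A.f + A.i (S x) - q₁ (S x) • A.e) = _
      rw [polar_sub_right, polar_add_right, polar_smul_right, smul_eq_mul, mul_comm (q₁ _)]
    rw [← h1] at hu
    have h2 : ε * polar Q B.e v = ε * u := by
      rw [hu]; linear_combination (1 - polar Q B.e v) * hε
    have h3 : (↑u⁻¹ : R) * u = 1 := u.inv_mul
    linear_combination (↑u⁻¹ : R) * h2 + ε * h3
  refine HSplit.isometry A B v 1 (↑u⁻¹) hQv ?_ ?_ ?_ ?_
  · intro m; rw [hAv]; simp
  · intro m
    conv_lhs => rw [← hε₁ m, smul_smul, mul_comm, hBv, hε₁]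
  · intro m; rw [hAv]; simp
  · intro m
    conv_lhs => rw [← hε₂ m, smul_smul, mul_comm, hBv, hε₂]

/-- Cancellation of a hyperbolic space on a free module. -/
theorem cancel_free {R : Type u} [CommRing R] (hR : IsLGRing R) (n : ℕ) :
    ∀ (M₁ M₂ : Type u) [AddCommGroup M₁] [Module R M₁] [AddCommGroup M₂] [Module R M₂]
    [Module.Finite R M₁] [Module.Projective R M₁]
    (q₁ : QuadraticForm R M₁) (q₂ : QuadraticForm R M₂) (_ : NZ q₁)
    (_ : QuadraticMap.Equivalent (q₁.prod (QuadraticForm.dualProd R (Fin n → R)))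
      (q₂.prod (QuadraticForm.dualProd R (Fin n → R)))),
    QuadraticMap.Equivalent q₁ q₂ := by
  induction n with
  | zero =>
    intro M₁ M₂ _ _ _ _ _ _ q₁ q₂ _ h
    have hz : ∀ (M : Type u) [AddCommGroup M] [Module R M] (q : QuadraticForm R M),
        QuadraticMap.Equivalent q (q.prod (QuadraticForm.dualProd R (Fin 0 → R))) := by
      intro M _ _ q
      have : Subsingleton (Module.Dual R (Fin 0 → R)) :=
        ⟨fun a b => LinearMap.ext fun x => by rw [Subsingleton.elim x 0, map_zero, map_zero]⟩
      let _ : Unique (Module.Dual R (Fin 0 → R) × (Fin 0 → R)) := Unique.mk' _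
      refine ⟨⟨(LinearEquiv.prodUnique (R := R) (M := M)
        (M₂ := Module.Dual R (Fin 0 → R) × (Fin 0 → R))).symm, fun m => ?_⟩⟩
      simp
      rw [Subsingleton.elim (default : Module.Dual R (Fin 0 → R) × (Fin 0 → R)) 0]
      rfl
    exact (hz M₁ q₁).trans (h.trans (hz M₂ q₂).symm)
  | succ n ih =>
    intro M₁ M₂ _ _ _ _ _ _ q₁ q₂ hq h
    have hz : ∀ (M : Type u) [AddCommGroup M] [Module R M] (q : QuadraticForm R M),
        QuadraticMap.Equivalent ((q.prod (QuadraticForm.dualProd R R)).prod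
          (QuadraticForm.dualProd R (Fin n → R)))
          (q.prod (QuadraticForm.dualProd R (Fin (n + 1) → R))) := by
      intro M _ _ q
      have h1 : QuadraticMap.Equivalent ((q.prod (QuadraticForm.dualProd R R)).prod
          (QuadraticForm.dualProd R (Fin n → R)))
          (q.prod ((QuadraticForm.dualProd R R).prod (QuadraticForm.dualProd R (Fin n → R)))) :=
        ⟨⟨LinearEquiv.prodAssoc R _ _ _, fun m => by
          simp [add_assoc]⟩⟩
      refine h1.trans (QuadraticMap.Equivalent.prod (.refl _) ?_)
      exact ⟨(QuadraticForm.dualProdProdIsometry.symm).trans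
        (QuadraticForm.dualProdIsometry (Fin.consLinearEquiv R (fun _ : Fin (n + 1) => R)))⟩
    obtain ⟨φ⟩ := ih (M₁ × (Module.Dual R R × R)) (M₂ × (Module.Dual R R × R))
      (q₁.prod (QuadraticForm.dualProd R R)) (q₂.prod (QuadraticForm.dualProd R R)) (by
        intro I hI h
        exact absurd ((Ideal.eq_top_iff_one I).2 (by simpa using h (0, LinearMap.id, 1)))
          hI.ne_top) ((hz M₁ q₁).trans (h.trans (hz M₂ q₂).symm))
    exact core hR q₁ q₂ hq φ

theorem prod_assoc_equiv {R A B C : Type*} [CommRing R] [AddCommGroup A] [Module R A]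
    [AddCommGroup B] [Module R B] [AddCommGroup C] [Module R C] (a : QuadraticForm R A)
    (b : QuadraticForm R B) (c : QuadraticForm R C) :
    QuadraticMap.Equivalent ((a.prod b).prod c) (a.prod (b.prod c)) :=
  ⟨⟨LinearEquiv.prodAssoc R _ _ _, fun m => by simp [add_assoc]⟩⟩

/-- `q ⊥ -q` is hyperbolic for regular `q`. -/
theorem regular_hyperbolic {R M : Type*} [CommRing R] [AddCommGroup M] [Module R M]
    [Module.Finite R M] [Module.Projective R M] (q : QuadraticForm R M) (h : IsRegularQF q) :
    QuadraticMap.Equivalent (q.prod (-q)) (QuadraticForm.dualProd R M) := by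
  let b : M ≃ₗ[R] Module.Dual R M := LinearEquiv.ofBijective q.polarBilin h
  obtain ⟨n, f, g, -, -, hfg⟩ := Module.Finite.exists_comp_eq_id_of_projective R M
  obtain ⟨B, hB⟩ : ∃ B : LinearMap.BilinMap R M R, ∀ x, B x x = q x := by
    obtain ⟨B, hB⟩ := LinearMap.BilinMap.toQuadraticMap_surjective (q.comp f)
    refine ⟨B.compl₁₂ g g, fun x => ?_⟩
    have := congrArg (fun Q => Q (g x)) hB
    simp only [LinearMap.BilinMap.toQuadraticMap_apply, QuadraticMap.comp_apply] at this
    rw [LinearMap.compl₁₂_apply, this, ← LinearMap.comp_apply, hfg, LinearMap.id_apply]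
  let s : M →ₗ[R] M := b.symm.toLinearMap ∘ₗ B
  have hs : ∀ x y, polar q (s x) y = B x y := fun x y => by
    have : b (s x) = B x := by simp [s]
    exact congrArg (fun l => l y) this
  symm
  let F : (Module.Dual R M × M) →ₗ[R] M × M :=
    LinearMap.coprod (LinearMap.prod b.symm.toLinearMap b.symm.toLinearMap)
      (LinearMap.prod s (s - LinearMap.id))
  let G : M × M →ₗ[R] (Module.Dual R M × M) :=
    LinearMap.prod (b.toLinearMap ∘ₗ (LinearMap.fst R M M -
      s ∘ₗ (LinearMap.fst R M M - LinearMap.snd R M M))) (LinearMap.fst R M M - LinearMap.snd R M M)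
  have hF : ∀ l x, F (l, x) = (b.symm l + s x, b.symm l + (s x - x)) := fun l x => rfl
  have hG : ∀ x y, G (x, y) = (b (x - s (x - y)), x - y) := fun l x => rfl
  refine ⟨⟨LinearEquiv.ofLinearMap F G ?_ ?_, ?_⟩⟩
  · refine LinearMap.ext ?_
    rintro ⟨x, y⟩
    rw [LinearMap.comp_apply, hG, hF, LinearEquiv.symm_apply_apply, LinearMap.id_apply]
    ext <;> dsimp only <;> abel
  · refine LinearMap.ext ?_
    rintro ⟨l, x⟩
    rw [LinearMap.comp_apply, hF, hG, LinearMap.id_apply]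
    have : b.symm l + s x - (b.symm l + (s x - x)) = x := by abel
    rw [this, add_sub_cancel_right, LinearEquiv.apply_symm_apply]
  · rintro ⟨l, x⟩
    change (q.prod (-q)) (F (l, x)) = l x
    rw [hF]
    obtain ⟨a, rfl⟩ := b.surjective l
    rw [LinearEquiv.symm_apply_apply]
    change q (a + s x) + -(q (a + (s x - x))) = polar q a x
    have e : a + (s x - x) = (a + s x) - (1 : R) • x := by module
    rw [e, Q_sub_smul, polar_add_left, hs, hB]
    ring

end LGCancel

/-- (Witt cancellation over LG-rings.)  Let `R` be an LG-ring, let `q₁`,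
`q₂` be nonsingular quadratic forms on finitely generated projective `R`-modules, and let
`q₃` be a regular quadratic form.  If `q₁ ⊥ q₃ ≅ q₂ ⊥ q₃`, then `q₁ ≅ q₂`. -/
theorem lg_ring_quadratic_form_cancellation
    {R : Type u} [CommRing R] (hR : IsLGRing R)
    {M₁ M₂ M₃ : Type u} [AddCommGroup M₁] [Module R M₁] [AddCommGroup M₂] [Module R M₂]
    [AddCommGroup M₃] [Module R M₃]
    [Module.Finite R M₁] [Module.Projective R M₁]
    [Module.Finite R M₂] [Module.Projective R M₂]
    [Module.Finite R M₃] [Module.Projective R M₃]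
    (q₁ : QuadraticForm R M₁) (q₂ : QuadraticForm R M₂) (q₃ : QuadraticForm R M₃)
    (h₁ : IsNonsingularQF q₁) (h₂ : IsNonsingularQF q₂) (h₃ : IsRegularQF q₃)
    (h : Nonempty (QuadraticMap.IsometryEquiv (q₁.prod q₃) (q₂.prod q₃))) :
    Nonempty (QuadraticMap.IsometryEquiv q₁ q₂) := by
  obtain ⟨n, f, g, -, -, hfg⟩ := Module.Finite.exists_comp_eq_id_of_projective R M₃
  -- `M₃ × ker f ≃ R^n`
  have hfg' : ∀ x, f (g x) = x := fun x => congrArg (fun l => l x) hfg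
  let N := LinearMap.ker f
  let E : (M₃ × N) ≃ₗ[R] (Fin n → R) := LinearEquiv.ofLinearMap
    (LinearMap.coprod g N.subtype)
    (LinearMap.prod f (LinearMap.codRestrict N (LinearMap.id - g ∘ₗ f) (by
      intro x; simp [N, hfg'])))
    (by ext x; simp)
    (by
      refine LinearMap.ext ?_
      rintro ⟨x, y, hy⟩
      have hy' : f y = 0 := hy
      ext <;> simp [hfg', hy'])
  have key : ∀ (M : Type u) [AddCommGroup M] [Module R M] (q : QuadraticForm R M),
      QuadraticMap.Equivalent (((q.prod q₃).prod (-q₃)).prod (QuadraticForm.dualProd R N))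
        (q.prod (QuadraticForm.dualProd R (Fin n → R))) := by
    intro M _ _ q
    have h1 := LGCancel.prod_assoc_equiv q q₃ (-q₃)
    have h2 : QuadraticMap.Equivalent (q.prod (q₃.prod (-q₃)))
      (q.prod (QuadraticForm.dualProd R M₃)) :=
      QuadraticMap.Equivalent.prod (.refl _) (LGCancel.regular_hyperbolic q₃ h₃)
    have h4 := QuadraticMap.Equivalent.prod (h1.trans h2) (.refl (QuadraticForm.dualProd R N))
    have h5 := LGCancel.prod_assoc_equiv q (QuadraticForm.dualProd R M₃)
      (QuadraticForm.dualProd R N)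
    refine (h4.trans h5).trans (QuadraticMap.Equivalent.prod (.refl _) ?_)
    exact ⟨(QuadraticForm.dualProdProdIsometry.symm).trans (QuadraticForm.dualProdIsometry E)⟩
  have h' : QuadraticMap.Equivalent (q₁.prod q₃) (q₂.prod q₃) := h
  have h6 := QuadraticMap.Equivalent.prod (QuadraticMap.Equivalent.prod h' (.refl (-q₃)))
    (.refl (QuadraticForm.dualProd R N))
  exact LGCancel.cancel_free hR n M₁ M₂ q₁ q₂ (LGCancel.NZ_of_nonsingular q₁ h₁)
    ((key M₁ q₁).symm.trans (h6.trans (key M₂ q₂)))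
end

section
/- Let R be a commutative ring, let S be a commutative R-algebra equipped with an R-linear algebra involution σ and which is finitely generated projective as an R-module, let M be a finitely generated projective S-module, and let h be an (S,σ)-sesquilinear form on M. Then the following are equivalent: (i) h is regular; (ii) the base change h_T is regular for every commutative R-algebra T; (iii) h_K is regular for every algebraically closed field K that is an R-algebra; (iv) h_{R_𝔪} is regular for every maximal ideal 𝔪 of R; (v) there exist f₁,…,fₙ ∈ R generating the unit ideal such that h_{R_{fᵢ}} is regular for every i; (vi) h_{R/𝔪} is regular for every maximal ideal 𝔪 of R; (vii) h_T is regular for some faithfully flat commutative R-algebra T. -/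
open TensorProduct

universe u

/-- `h` is an `(S,σ)`-sesquilinear form on the `S`-module `M`:  biadditive,
`σ`-semilinear in the first variable and linear in the second variable. -/
def IsSesquilinearForm {R S : Type u} [CommRing R] [CommRing S] [Algebra R S]
    (σ : S →ₐ[R] S) {M : Type u} [AddCommGroup M] [Module S M] (h : M → M → S) : Prop :=
  (∀ m m₁ m₂ : M, h (m₁ + m₂) m = h m₁ m + h m₂ m) ∧
  (∀ m m₁ m₂ : M, h m (m₁ + m₂) = h m m₁ + h m m₂) ∧
  (∀ (s : S) (m m' : M), h (s • m) m' = σ s * h m m') ∧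
  (∀ (s : S) (m m' : M), h m (s • m') = h m m' * s)

/-- The base change of a sesquilinear form `h` along `R → T` is regular.  Here the base
change `M_T` of `M` is realised as `(S ⊗_R T) ⊗_S M`, and `h_T` is the unique biadditive
form on it satisfying `h_T(x ⊗ m, y ⊗ m') = σ_T(x)·y·h(m,m')` where `σ_T = σ ⊗ id`. -/
def BaseChangeRegular (R : Type u) [CommRing R] (S : Type u) [CommRing S] [Algebra R S]
    (σ : S →ₐ[R] S) (M : Type u) [AddCommGroup M] [Module S M] (h : M → M → S)
    (T : Type u) [CommRing T] [Algebra R T] : Prop :=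
  ∀ H : ((S ⊗[R] T) ⊗[S] M) → ((S ⊗[R] T) ⊗[S] M) → (S ⊗[R] T),
    (∀ z w w', H z (w + w') = H z w + H z w') →
    (∀ z z' w, H (z + z') w = H z w + H z' w) →
    (∀ (x y : S ⊗[R] T) (m m' : M),
      H (x ⊗ₜ[S] m) (y ⊗ₜ[S] m') =
        Algebra.TensorProduct.map σ (AlgHom.id R T) x * y *
          algebraMap S (S ⊗[R] T) (h m m')) →
    ((∀ z z', (∀ w, H z w = H z' w) → z = z') ∧
     (∀ φ : ((S ⊗[R] T) ⊗[S] M) →ₗ[S ⊗[R] T] (S ⊗[R] T), ∃ z, ∀ w, H z w = φ w))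

/-- A bundled commutative `R`-algebra. -/
structure CommAlgebraOver (R : Type u) [CommRing R] where
  carrier : Type u
  [commRing : CommRing carrier]
  [algebra : Algebra R carrier]

attribute [instance] CommAlgebraOver.commRing CommAlgebraOver.algebra


lemma aux_surjective_of_residue {R P Q : Type*} [CommRing R] [AddCommGroup P] [Module R P]
    [AddCommGroup Q] [Module R Q] [Module.Finite R Q] (f : P →ₗ[R] Q)
    (hf : ∀ 𝔪 : Ideal R, 𝔪.IsMaximal → Function.Surjective (f.lTensor (R ⧸ 𝔪))) :
    Function.Surjective f := by
  rw [← LinearMap.range_eq_top]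
  by_contra hne
  have hC : Nontrivial (Q ⧸ LinearMap.range f) := Submodule.Quotient.nontrivial_iff.mpr hne
  have hann : Module.annihilator R (Q ⧸ LinearMap.range f) ≠ ⊤ := by
    intro h
    rw [Module.annihilator_eq_top_iff] at h
    exact not_subsingleton _ h
  obtain ⟨𝔪, h𝔪, hle⟩ := Ideal.exists_le_maximal _ hann
  have h0 : (LinearMap.range f).mkQ ∘ₗ f = 0 := LinearMap.range_mkQ_comp f
  have h1 : ∀ x : (R ⧸ 𝔪) ⊗[R] (Q ⧸ LinearMap.range f), x = 0 := by
    intro x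
    obtain ⟨y, rfl⟩ := LinearMap.lTensor_surjective (R ⧸ 𝔪) (Submodule.mkQ_surjective _) x
    obtain ⟨z, rfl⟩ := hf 𝔪 h𝔪 y
    rw [← LinearMap.comp_apply, ← LinearMap.lTensor_comp, h0]
    simp
  have h2 : Subsingleton ((Q ⧸ LinearMap.range f) ⧸
      (𝔪 • (⊤ : Submodule R (Q ⧸ LinearMap.range f)))) :=
    have : Subsingleton ((R ⧸ 𝔪) ⊗[R] (Q ⧸ LinearMap.range f)) :=
      ⟨fun a b => by rw [h1 a, h1 b]⟩
    (TensorProduct.quotTensorEquivQuotSMul (Q ⧸ LinearMap.range f) 𝔪).symm.toEquiv.subsingleton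
  rw [Submodule.Quotient.subsingleton_iff] at h2
  obtain ⟨r, hr, hr'⟩ := Submodule.exists_sub_one_mem_and_smul_eq_zero_of_fg_of_le_smul 𝔪
    (⊤ : Submodule R (Q ⧸ LinearMap.range f)) Module.Finite.fg_top h2.ge
  have h3 : r ∈ 𝔪 := hle (Module.mem_annihilator.mpr fun n => hr' n trivial)
  refine h𝔪.ne_top ((Ideal.eq_top_iff_one _).mpr ?_)
  have := 𝔪.sub_mem h3 hr
  simpa using this

lemma aux_bijective_of_residue {R P Q : Type*} [CommRing R] [AddCommGroup P] [Module R P]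
    [AddCommGroup Q] [Module R Q] [Module.Finite R P] [Module.Finite R Q] [Module.Projective R Q]
    (f : P →ₗ[R] Q)
    (hf : ∀ 𝔪 : Ideal R, 𝔪.IsMaximal → Function.Bijective (f.lTensor (R ⧸ 𝔪))) :
    Function.Bijective f := by
  have hs := aux_surjective_of_residue f fun m hm => (hf m hm).2
  obtain ⟨s, hs'⟩ := Module.projective_lifting_property f LinearMap.id hs
  have hss : Function.Surjective s := by
    refine aux_surjective_of_residue s fun m hm y => ?_
    refine ⟨f.lTensor _ y, (hf m hm).1 ?_⟩
    rw [← LinearMap.comp_apply, ← LinearMap.lTensor_comp, hs']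
    simp
  refine ⟨fun a b hab => ?_, hs⟩
  obtain ⟨a, rfl⟩ := hss a
  obtain ⟨b, rfl⟩ := hss b
  have := LinearMap.congr_fun hs'
  simp only [LinearMap.comp_apply, LinearMap.id_apply] at this
  rw [this, this] at hab
  rw [hab]

lemma aux_tower {R P Q : Type*} [CommRing R] [AddCommGroup P] [Module R P]
    [AddCommGroup Q] [Module R Q] (f : P →ₗ[R] Q) (T T' : Type*) [CommRing T] [Algebra R T]
    [CommRing T'] [Algebra R T'] [Algebra T T'] [IsScalarTower R T T'] :
    Function.Bijective ((f.baseChange T).lTensor T') ↔ Function.Bijective (f.lTensor T') := by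
  let eP := AlgebraTensorModule.cancelBaseChange R T T T' P
  let eQ := AlgebraTensorModule.cancelBaseChange R T T T' Q
  have hcomm : ∀ x, eQ ((f.baseChange T).lTensor T' x) = f.lTensor T' (eP x) := by
    intro x
    induction x with
    | zero => simp
    | add x y hx hy => simp only [map_add, hx, hy]
    | tmul t y =>
      induction y with
      | zero => simp
      | add x y hx hy => simp only [map_add, tmul_add, hx, hy]
      | tmul s m => simp [eP, eQ]
  have : (f.lTensor T' : T' ⊗[R] P → T' ⊗[R] Q) ∘ eP = eQ ∘ ((f.baseChange T).lTensor T') :=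
    funext fun x => (hcomm x).symm
  rw [← Function.Bijective.of_comp_iff _ eP.bijective, this,
    Function.Bijective.of_comp_iff' eQ.bijective]

lemma aux_tower_up {R P Q : Type*} [CommRing R] [AddCommGroup P] [Module R P]
    [AddCommGroup Q] [Module R Q] (f : P →ₗ[R] Q) (T T' : Type*) [CommRing T] [Algebra R T]
    [CommRing T'] [Algebra R T'] [Algebra T T'] [IsScalarTower R T T']
    (h : Function.Bijective (f.lTensor T)) : Function.Bijective (f.lTensor T') := by
  rw [← aux_tower f T T']
  let e := LinearEquiv.ofBijective (f.baseChange T) h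
  exact (e.lTensor T').bijective

lemma aux_tower_down {R P Q : Type*} [CommRing R] [AddCommGroup P] [Module R P]
    [AddCommGroup Q] [Module R Q] (f : P →ₗ[R] Q) (T T' : Type*) [CommRing T] [Algebra R T]
    [CommRing T'] [Algebra R T'] [Algebra T T'] [IsScalarTower R T T']
    [Module.FaithfullyFlat T T']
    (h : Function.Bijective (f.lTensor T')) : Function.Bijective (f.lTensor T) := by
  rw [← aux_tower f T T', Module.FaithfullyFlat.lTensor_bijective_iff_bijective] at h
  exact h

/-- The comparison map from the base change of the dual to the dual of the base change. -/
noncomputable def auxDual (A B M : Type*) [CommRing A] [CommRing B] [Algebra A B]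
    [AddCommGroup M] [Module A M] :
    B ⊗[A] (M →ₗ[A] A) →ₗ[B] ((B ⊗[A] M) →ₗ[B] B) :=
  LinearMap.liftBaseChange B
    (Module.Dual.baseChange B : Module.Dual A M →ₗ[A] Module.Dual B (B ⊗[A] M))

lemma auxDual_tmul (A B M : Type*) [CommRing A] [CommRing B] [Algebra A B]
    [AddCommGroup M] [Module A M] (b y : B) (f : M →ₗ[A] A) (m : M) :
    auxDual A B M (b ⊗ₜ f) (y ⊗ₜ m) = b * y * algebraMap A B (f m) := by
  have : Module.Dual.baseChange B f (y ⊗ₜ m) = f m • y := Module.Dual.baseChange_apply_tmul _ _ _ _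
  simp only [auxDual, LinearMap.liftBaseChange_tmul]
  erw [LinearMap.smul_apply, this]
  rw [Algebra.smul_def (f m)]
  ring

lemma auxDual_bijective (A B M : Type*) [CommRing A] [CommRing B] [Algebra A B]
    [AddCommGroup M] [Module A M] [Module.Finite A M] [Module.Projective A M] :
    Function.Bijective (auxDual A B M) := by
  obtain ⟨n, p, hp⟩ := Module.Finite.exists_fin' A M
  obtain ⟨s, hs⟩ := Module.projective_lifting_property p LinearMap.id hp
  let m : Fin n → M := fun i => p (Pi.single i 1)
  let f : Fin n → (M →ₗ[A] A) := fun i => LinearMap.proj i ∘ₗ s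
  have hmf : ∀ x : M, ∑ i, f i x • m i = x := by
    intro x
    have h1 := LinearMap.congr_fun hs x
    simp only [LinearMap.comp_apply, LinearMap.id_apply] at h1
    conv_rhs => rw [← h1, pi_eq_sum_univ' (s x), map_sum]
    refine Finset.sum_congr rfl fun i _ => ?_
    simp only [f, m, LinearMap.comp_apply, LinearMap.proj_apply]
    rw [← map_smul]
  let inv : ((B ⊗[A] M) →ₗ[B] B) → B ⊗[A] (M →ₗ[A] A) := fun φ =>
    ∑ i, φ (1 ⊗ₜ m i) ⊗ₜ f i
  have inv_add : ∀ φ ψ, inv (φ + ψ) = inv φ + inv ψ := by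
    intro φ ψ
    simp only [inv, LinearMap.add_apply, add_tmul, Finset.sum_add_distrib]
  refine Function.bijective_iff_has_inverse.mpr ⟨inv, ?_, ?_⟩
  · intro x
    induction x with
    | zero => simp [inv]
    | add x y hx hy => rw [map_add, inv_add, hx, hy]
    | tmul b g =>
      simp only [inv, auxDual_tmul, mul_one]
      have : ∀ i, (b * algebraMap A B (g (m i))) ⊗ₜ[A] f i = b ⊗ₜ[A] (g (m i) • f i) := by
        intro i
        rw [mul_comm, ← Algebra.smul_def, smul_tmul]
      simp only [this]
      rw [← tmul_sum]
      congr 1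
      ext x
      conv_rhs => rw [← hmf x, map_sum]
      simp [mul_comm]
  · intro φ
    ext x
    simp only [inv, map_sum, LinearMap.sum_apply, AlgebraTensorModule.curry_apply,
      curry_apply, auxDual_tmul, LinearMap.coe_restrictScalars]
    conv_rhs => rw [← hmf x, tmul_sum, map_sum]
    refine Finset.sum_congr rfl fun i _ => ?_
    rw [tmul_smul, LinearMap.map_smul_of_tower]
    simp [Algebra.smul_def, mul_comm]

lemma aux_projective_trans (R S N : Type*) [CommRing R] [CommRing S] [Algebra R S]
    [AddCommGroup N] [Module R N] [Module S N] [IsScalarTower R S N] [Module.Projective R S]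
    [Module.Finite S N] [Module.Projective S N] : Module.Projective R N := by
  obtain ⟨n, p, hp⟩ := Module.Finite.exists_fin' S N
  obtain ⟨s, hs⟩ := Module.projective_lifting_property p LinearMap.id hp
  have : Module.Projective R (Fin n → S) := Module.Projective.of_equiv
    (DirectSum.linearEquivFunOnFintype R (Fin n) (fun _ => S))
  exact Module.Projective.of_split (s.restrictScalars R) (p.restrictScalars R)
    (LinearMap.ext fun x => LinearMap.congr_fun hs x)

section AuxRight

attribute [local instance] Algebra.TensorProduct.rightAlgebra

lemma aux_cancel (R S T N : Type*) [CommRing R] [CommRing S] [Algebra R S] [CommRing T]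
    [Algebra R T] [AddCommGroup N] [Module R N] [Module S N] [IsScalarTower R S N] :
    ∃ e : (T ⊗[R] N) ≃+ ((S ⊗[R] T) ⊗[S] N),
      ∀ (t : T) (n : N), e (t ⊗ₜ n) = ((1 : S) ⊗ₜ[R] t) ⊗ₜ[S] n := by
  refine ⟨(Algebra.IsPushout.cancelBaseChange R T S (S ⊗[R] T) N).symm.toAddEquiv, ?_⟩
  intro t n
  exact Algebra.IsPushout.cancelBaseChange_symm_tmul R T S (S ⊗[R] T) N t n

end AuxRight

/-- The adjoint of a sesquilinear form, as an `R`-linear map. -/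
def auxAdj {R S : Type u} [CommRing R] [CommRing S] [Algebra R S]
    (σ : S →ₐ[R] S) {M : Type u} [AddCommGroup M] [Module S M] [Module R M] [IsScalarTower R S M]
    (h : M → M → S) (hses : IsSesquilinearForm σ h) : M →ₗ[R] (M →ₗ[S] S) where
  toFun m :=
    { toFun := h m
      map_add' := hses.2.1 m
      map_smul' := fun s x => by rw [hses.2.2.2, smul_eq_mul, mul_comm]; rfl }
  map_add' m₁ m₂ := by
    ext x
    exact hses.1 x m₁ m₂
  map_smul' r m := by
    ext x
    change h (r • m) x = r • h m x
    rw [← algebraMap_smul S r m, hses.2.2.1, AlgHom.commutes, Algebra.smul_def]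

lemma aux_regular_iff {R S : Type u} [CommRing R] [CommRing S] [Algebra R S]
    (σ : S →ₐ[R] S) {M : Type u} [AddCommGroup M] [Module S M] [Module R M] [IsScalarTower R S M]
    (h : M → M → S) (hses : IsSesquilinearForm σ h) :
    IsRegularForm h ↔ Function.Bijective (auxAdj σ h hses) := by
  refine and_congr ⟨fun H m m' e => H m m' fun x => LinearMap.congr_fun e x,
    fun H m m' e => H (LinearMap.ext e)⟩
    ⟨fun H φ => (H φ).imp fun m hm => LinearMap.ext hm,
      fun H φ => (H φ).imp fun m hm => LinearMap.congr_fun hm⟩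

lemma aux_baseChange_iff {R S : Type u} [CommRing R] [CommRing S] [Algebra R S]
    (σ : S →ₐ[R] S) {M : Type u} [AddCommGroup M] [Module S M] [Module R M] [IsScalarTower R S M]
    [Module.Finite S M] [Module.Projective S M]
    (h : M → M → S) (hses : IsSesquilinearForm σ h) (T : Type u) [CommRing T] [Algebra R T] :
    BaseChangeRegular R S σ M h T ↔ Function.Bijective ((auxAdj σ h hses).lTensor T) := by
  obtain ⟨eM, heM⟩ := aux_cancel R S T M
  obtain ⟨eD, heD⟩ := aux_cancel R S T (M →ₗ[S] S)
  let G : ((S ⊗[R] T) ⊗[S] M) → (((S ⊗[R] T) ⊗[S] M) →ₗ[S ⊗[R] T] (S ⊗[R] T)) :=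
    auxDual S (S ⊗[R] T) M ∘ eD ∘ (auxAdj σ h hses).lTensor T ∘ eM.symm
  have hGadd : ∀ z z', G (z + z') = G z + G z' := by
    intro z z'
    simp only [G, Function.comp_apply, map_add]
  have hG1 : ∀ (t : T) (y : S ⊗[R] T) (m m' : M),
      G (((1 : S) ⊗ₜ[R] t) ⊗ₜ[S] m) (y ⊗ₜ[S] m') =
        ((1 : S) ⊗ₜ[R] t) * y * algebraMap S (S ⊗[R] T) (h m m') := by
    intro t y m m'
    simp only [G, Function.comp_apply]
    rw [← heM, AddEquiv.symm_apply_apply, LinearMap.lTensor_tmul, heD, auxDual_tmul]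
    rfl
  have hG : ∀ (x y : S ⊗[R] T) (m m' : M), G (x ⊗ₜ[S] m) (y ⊗ₜ[S] m') =
      Algebra.TensorProduct.map σ (AlgHom.id R T) x * y *
          algebraMap S (S ⊗[R] T) (h m m') := by
    intro x y m m'
    induction x with
    | zero =>
      have : G 0 = 0 := by simp [G]
      simp [this]
    | add a b ha hb => rw [add_tmul, hGadd, LinearMap.add_apply, ha, hb, map_add, add_mul, add_mul]
    | tmul s t =>
      have h1 : (s ⊗ₜ[R] t : S ⊗[R] T) = s • ((1 : S) ⊗ₜ[R] t) := by
        rw [smul_tmul', smul_eq_mul, mul_one]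
      have h2 : (σ s ⊗ₜ[R] t : S ⊗[R] T) =
          algebraMap S (S ⊗[R] T) (σ s) * ((1 : S) ⊗ₜ[R] t) := by
        simp
      rw [Algebra.TensorProduct.map_tmul, AlgHom.id_apply, h2, h1, smul_tmul, hG1, hses.2.2.1,
        map_mul]
      ring
  have hGbij : Function.Bijective G ↔ Function.Bijective ((auxAdj σ h hses).lTensor T) := by
    simp only [G]
    rw [Function.Bijective.of_comp_iff' (auxDual_bijective S (S ⊗[R] T) M),
      Function.Bijective.of_comp_iff' eD.bijective, Function.Bijective.of_comp_iff _
        eM.symm.bijective]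
  rw [← hGbij]
  constructor
  · intro H
    obtain ⟨h1, h2⟩ := H (fun z w => G z w) (fun z w w' => map_add _ _ _)
      (fun z z' w => by rw [hGadd]; rfl) hG
    exact ⟨fun z z' e => h1 z z' fun w => LinearMap.congr_fun e w,
      fun φ => (h2 φ).imp fun z hz => LinearMap.ext hz⟩
  · intro hb H hadd₂ hadd₁ hH
    have hHG : ∀ z w, H z w = G z w := by
      intro z w
      have hz0 : ∀ w, H 0 w = 0 := fun w => by simpa using hadd₁ 0 0 w
      have hw0 : ∀ z, H z 0 = 0 := fun z => by simpa using hadd₂ z 0 0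
      induction z with
      | zero =>
        have : G 0 = 0 := by simp [G]
        rw [hz0, this]; rfl
      | add a b ha hb => rw [hadd₁, hGadd, ha, hb]; rfl
      | tmul x m =>
        induction w with
        | zero => rw [hw0, map_zero]
        | add a b ha hb => rw [hadd₂, map_add, ha, hb]
        | tmul y m' => rw [hH, hG]
    simp only [hHG]
    exact ⟨fun z z' e => hb.1 (LinearMap.ext e),
      fun φ => (hb.2 φ).imp fun z hz => LinearMap.congr_fun hz⟩

lemma aux_away {R P Q : Type*} [CommRing R] [AddCommGroup P] [Module R P]
    [AddCommGroup Q] [Module R Q] (f : P →ₗ[R] Q) (𝔪 : Ideal R) (h𝔪 : 𝔪.IsMaximal)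
    (W : Submonoid R) (hW : W ≤ 𝔪.primeCompl)
    (h : Function.Bijective (f.lTensor (Localization W))) :
    Function.Bijective (f.lTensor (R ⧸ 𝔪)) := by
  let _ : Field (R ⧸ 𝔪) := Ideal.Quotient.field 𝔪
  let g : Localization W →+* R ⧸ 𝔪 := IsLocalization.lift (M := W) (g := algebraMap R (R ⧸ 𝔪))
    (fun y => IsUnit.mk0 _ fun h0 => hW y.2 (Ideal.Quotient.eq_zero_iff_mem.mp h0))
  letI : Algebra (Localization W) (R ⧸ 𝔪) := g.toAlgebra
  haveI : IsScalarTower R (Localization W) (R ⧸ 𝔪) := IsScalarTower.of_algebraMap_eq fun r =>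
    (IsLocalization.lift_eq _ r).symm
  exact aux_tower_up f (Localization W) (R ⧸ 𝔪) h

lemma aux_closed {R P Q : Type*} [CommRing R] [AddCommGroup P] [Module R P]
    [AddCommGroup Q] [Module R Q] (f : P →ₗ[R] Q) (k K : Type*) [Field k] [Algebra R k]
    [Field K] [Algebra k K] [Algebra R K] [IsScalarTower R k K]
    (h : Function.Bijective (f.lTensor K)) :
    Function.Bijective (f.lTensor k) :=
  aux_tower_down f k K h

/-- Let `S` be a commutative `R`-algebra with an `R`-linear involution
`σ`, finitely generated projective as an `R`-module, `M` a finitely generated projective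
`S`-module and `h` an `(S,σ)`-sesquilinear form on `M`.  Then the following are
equivalent: (i) `h` is regular; (ii) `h_T` is regular for every commutative `R`-algebra
`T`; (iii) `h_K` is regular for every algebraically closed field `K` over `R`;
(iv) `h_{R_𝔪}` is regular for every maximal ideal `𝔪`; (v) `h_{R_{fᵢ}}` is regular for
some `f₁,…,fₙ` generating the unit ideal; (vi) `h_{R/𝔪}` is regular for every maximal
ideal `𝔪`; (vii) `h_T` is regular for some faithfully flat commutative `R`-algebra `T`. -/
theorem sesquilinear_regular_tfae
    {R : Type u} [CommRing R] (S : Type u) [CommRing S] [Algebra R S]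
    [Module.Finite R S] [Module.Projective R S]
    (σ : S →ₐ[R] S) (hσinv : ∀ s : S, σ (σ s) = s)
    (M : Type u) [AddCommGroup M] [Module S M]
    [Module.Finite S M] [Module.Projective S M]
    (h : M → M → S) (hses : IsSesquilinearForm σ h) :
    (IsRegularForm h ↔
      ∀ (T : Type u) [CommRing T] [Algebra R T], BaseChangeRegular R S σ M h T) ∧
    (IsRegularForm h ↔
      ∀ (K : Type u) [Field K] [IsAlgClosed K] [Algebra R K],
        BaseChangeRegular R S σ M h K) ∧
    (IsRegularForm h ↔
      ∀ (𝔪 : Ideal R) (h𝔪 : 𝔪.IsMaximal),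
        haveI := h𝔪.isPrime
        BaseChangeRegular R S σ M h (Localization 𝔪.primeCompl)) ∧
    (IsRegularForm h ↔
      ∃ (n : ℕ) (f : Fin n → R), Ideal.span (Set.range f) = ⊤ ∧
        ∀ i, BaseChangeRegular R S σ M h (Localization.Away (f i))) ∧
    (IsRegularForm h ↔
      ∀ 𝔪 : Ideal R, 𝔪.IsMaximal → BaseChangeRegular R S σ M h (R ⧸ 𝔪)) ∧
    (IsRegularForm h ↔
      ∃ T : CommAlgebraOver R, Module.FaithfullyFlat R T.carrier ∧
        BaseChangeRegular R S σ M h T.carrier) := by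
  letI : Module R M := Module.compHom M (algebraMap R S)
  haveI : IsScalarTower R S M := IsScalarTower.of_algebraMap_smul fun r x => rfl
  haveI : Module.Finite R M := Module.Finite.trans S M
  haveI : Module.Finite R (M →ₗ[S] S) := Module.Finite.trans S (M →ₗ[S] S)
  haveI : Module.Projective S (M →ₗ[S] S) := inferInstance
  haveI : Module.Projective R (M →ₗ[S] S) := aux_projective_trans R S (M →ₗ[S] S)
  simp only [aux_regular_iff σ h hses, aux_baseChange_iff σ h hses]
  generalize auxAdj σ h hses = Φ
  have all : Function.Bijective Φ → ∀ (T : Type u) [CommRing T] [Algebra R T],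
      Function.Bijective (Φ.lTensor T) := fun hb T _ _ =>
    ((LinearEquiv.ofBijective Φ hb).lTensor T).bijective
  have res : (∀ 𝔪 : Ideal R, 𝔪.IsMaximal → Function.Bijective (Φ.lTensor (R ⧸ 𝔪))) →
      Function.Bijective Φ := aux_bijective_of_residue Φ
  have ff : ∀ (T : Type u) [CommRing T] [Algebra R T] [Module.FaithfullyFlat R T],
      Function.Bijective (Φ.lTensor T) → Function.Bijective Φ := fun T _ _ _ hb =>
    (Module.FaithfullyFlat.lTensor_bijective_iff_bijective R T Φ).mp hb
  refine ⟨⟨all, fun H => ff R (H R)⟩, ⟨fun hb K _ _ _ => all hb K, fun H => res ?_⟩,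
    ⟨fun hb 𝔪 _ => all hb _, fun H => res ?_⟩, ⟨fun hb => ?_, ?_⟩,
    ⟨fun hb 𝔪 _ => all hb _, res⟩,
    ⟨fun hb => ⟨⟨R⟩, inferInstanceAs (Module.FaithfullyFlat R R), all hb R⟩, ?_⟩⟩
  · intro 𝔪 h𝔪
    letI : Field (R ⧸ 𝔪) := Ideal.Quotient.field 𝔪
    exact aux_closed Φ (R ⧸ 𝔪) (AlgebraicClosure (R ⧸ 𝔪)) (H (AlgebraicClosure (R ⧸ 𝔪)))
  · intro 𝔪 h𝔪
    haveI := h𝔪.isPrime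
    exact aux_away Φ 𝔪 h𝔪 𝔪.primeCompl le_rfl (H 𝔪 h𝔪)
  · exact ⟨1, fun _ => 1, by simp, fun i => all hb _⟩
  · rintro ⟨n, f, hf, H⟩
    refine res fun 𝔪 h𝔪 => ?_
    haveI := h𝔪.isPrime
    obtain ⟨i, hi⟩ : ∃ i, f i ∉ 𝔪 := by
      by_contra hcon
      push Not at hcon
      refine h𝔪.ne_top (top_le_iff.mp (hf ▸ Ideal.span_le.mpr ?_))
      rintro _ ⟨i, rfl⟩
      exact hcon i
    exact aux_away Φ 𝔪 h𝔪 (Submonoid.powers (f i)) (Submonoid.powers_le.mpr hi) (H i)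
  · rintro ⟨T, hT, H⟩
    exact ff T.carrier H
end
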